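/- Consider SSBM(n,2,a/n,b/n) with constants a,b ≥ 0. If (a−b)² > 2(a+b), then weak recovery is solvable: there exist ε > 0 and a sequence of estimators X̂_n mapping n-vertex graphs to {1,2}^n such that P(A(X, X̂_n(G)) ≥ 1/2 + ε) → 1 as n → ∞. -/

import Mathlib

open Filter
open scoped Classical

abbrev VPair (n : ℕ) := {e : Fin n × Fin n // e.1 < e.2}

noncomputable def sbmMass {n k : ℕ} (p : Fin k → ℝ) (W : Matrix (Fin k) (Fin k) ℝ)
    (x : Fin n → Fin k) (g : VPair n → Bool) : ℝ :=
  (∏ u, p (x u)) *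
    ∏ e : VPair n,
      if g e then W (x e.1.1) (x e.1.2) else 1 - W (x e.1.1) (x e.1.2)

noncomputable def sbmProb {n k : ℕ} (p : Fin k → ℝ) (W : Matrix (Fin k) (Fin k) ℝ)
    (E : (Fin n → Fin k) → (VPair n → Bool) → Prop) : ℝ :=
  ∑ x : Fin n → Fin k, ∑ g : VPair n → Bool,
    if E x g then sbmMass p W x g else 0

noncomputable def agreement {n k : ℕ} (x y : Fin n → Fin k) : ℝ :=
  (Finset.univ : Finset (Equiv.Perm (Fin k))).sup' ⟨1, Finset.mem_univ 1⟩
    fun π => ((Finset.univ.filter fun i : Fin n => x i = π (y i)).card : ℝ) / n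


def ssbmW (k : ℕ) (A B : ℝ) : Matrix (Fin k) (Fin k) ℝ :=
  Matrix.of fun i j => if i = j then A else B

namespace BlockModel

/-- The sign `±1` attached to a community label. -/
noncomputable def sg (i : Fin 2) : ℝ := if i = 0 then 1 else -1

lemma sg_mul_self (i : Fin 2) : sg i * sg i = 1 := by
  unfold sg; split_ifs <;> norm_num

lemma abs_sg (i : Fin 2) : |sg i| = 1 := by
  unfold sg; split_ifs <;> norm_num

lemma sg_swap (i : Fin 2) : sg (Equiv.swap 0 1 i) = -sg i := by
  fin_cases i <;> simp [sg]

lemma indicator_eq (i j : Fin 2) : (if i = j then (1 : ℝ) else 0) = (1 + sg i * sg j) / 2 := by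
  fin_cases i <;> fin_cases j <;> simp [sg]

/-- The signed overlap of two labellings. -/
noncomputable def overlap {n : ℕ} (x y : Fin n → Fin 2) : ℝ := ∑ u, sg (x u) * sg (y u)

lemma card_eq_overlap {n : ℕ} (x y : Fin n → Fin 2) :
    ((Finset.univ.filter fun i : Fin n => x i = y i).card : ℝ) = (n + overlap x y) / 2 := by
  rw [Finset.card_filter]
  push_cast
  simp_rw [indicator_eq]
  rw [← Finset.sum_div, Finset.sum_add_distrib]
  simp [overlap]

lemma le_agreement {n : ℕ} (hn : 0 < n) (x y : Fin n → Fin 2) {c : ℝ}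
    (h : c * n ≤ |overlap x y|) : 1 / 2 + c / 2 ≤ agreement x y := by
  have hn' : (0 : ℝ) < n := by exact_mod_cast hn
  unfold agreement
  rcases le_total 0 (overlap x y) with h0 | h0
  · rw [abs_of_nonneg h0] at h
    refine le_trans ?_ (Finset.le_sup' _ (Finset.mem_univ (1 : Equiv.Perm (Fin 2))))
    have := card_eq_overlap x y
    refine le_trans (b := ((Finset.univ.filter fun i : Fin n => x i = y i).card : ℝ) / n) ?_
      (le_of_eq rfl)
    rw [this, le_div_iff₀ hn']
    linarith
  · rw [abs_of_nonpos h0] at h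
    refine le_trans ?_ (Finset.le_sup' _ (Finset.mem_univ (Equiv.swap (0 : Fin 2) 1)))
    have := card_eq_overlap x (fun i => Equiv.swap (0 : Fin 2) 1 (y i))
    have h2 : overlap x (fun i => Equiv.swap (0 : Fin 2) 1 (y i)) = - overlap x y := by
      simp only [overlap, sg_swap, mul_neg, Finset.sum_neg_distrib]
    rw [h2] at this
    rw [this, le_div_iff₀ hn']
    linarith

/-- A randomized estimator can be replaced by a deterministic one that is at least as good. -/
lemma exists_deterministic {X G C Y : Type*} [Fintype X] [Fintype G] [Fintype C]
    (w : C → ℝ) (hw : ∀ c, 0 ≤ w c) (hw1 : ∑ c, w c = 1) (m : X → G → ℝ)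
    (f : G → C → Y) (succ : X → Y → Prop) :
    ∃ est : G → Y, ∑ x, ∑ g, ∑ c, (if succ x (f g c) then m x g * w c else 0) ≤
      ∑ x, ∑ g, if succ x (est g) then m x g else 0 := by
  have hne : (Finset.univ : Finset C).Nonempty := by
    by_contra hc
    rw [Finset.not_nonempty_iff_eq_empty] at hc
    rw [hc] at hw1
    simp at hw1
  choose c₀ _ hc₀ using fun g => Finset.exists_max_image Finset.univ
    (fun c => ∑ x, if succ x (f g c) then m x g else 0) hne
  refine ⟨fun g => f g (c₀ g), ?_⟩
  rw [Finset.sum_comm, Finset.sum_comm (s := (Finset.univ : Finset X))]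
  refine Finset.sum_le_sum fun g _ => ?_
  rw [Finset.sum_comm]
  calc ∑ c, ∑ x, (if succ x (f g c) then m x g * w c else 0)
      = ∑ c, w c * ∑ x, (if succ x (f g c) then m x g else 0) := by
        refine Finset.sum_congr rfl fun c _ => ?_
        rw [Finset.mul_sum]
        refine Finset.sum_congr rfl fun x _ => ?_
        split_ifs <;> ring
    _ ≤ ∑ c, w c * ∑ x, (if succ x (f g (c₀ g)) then m x g else 0) :=
        Finset.sum_le_sum fun c _ => mul_le_mul_of_nonneg_left (hc₀ g c (Finset.mem_univ c)) (hw c)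
    _ = _ := by rw [← Finset.sum_mul, hw1, one_mul]

/-- The weight of a pair (edge indicator, coin), an edge having probability `p` and the coin
coming up `true` with probability `q`. -/
noncomputable def pairWeight (q p : ℝ) (l : Bool × Bool) : ℝ :=
  (if l.1 then p else 1 - p) * (if l.2 then q else 1 - q)

/-- The indicator that an edge is kept for the first layer. -/
def fstLayer (l : Bool × Bool) : Bool := l.1 && !l.2

/-- The indicator that an edge is kept for the second layer. -/
def sndLayer (l : Bool × Bool) : Bool := l.1 && l.2

lemma pairWeight_nonneg {q p : ℝ} (hq : 0 ≤ q) (hq1 : q ≤ 1) (hp : 0 ≤ p) (hp1 : p ≤ 1)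
    (l : Bool × Bool) : 0 ≤ pairWeight q p l := by
  unfold pairWeight
  refine mul_nonneg ?_ ?_ <;> split_ifs <;> linarith

lemma sum_pairWeight (q p : ℝ) : ∑ l, pairWeight q p l = 1 := by
  rw [Fintype.sum_prod_type]
  simp [pairWeight]
  ring

/-- The probability of a pair of first-layer and second-layer subsets, per pair of vertices. -/
lemma sum_pairWeight_fstLayer (q p : ℝ) :
    ∑ l, pairWeight q p l * (if fstLayer l = true then 1 else 0) = (1 - q) * p := by
  rw [Fintype.sum_prod_type]
  simp [pairWeight, fstLayer, mul_comm]

/-- The average over a uniformly random labelling. -/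
noncomputable def avg {n : ℕ} (F : (Fin n → Fin 2) → ℝ) : ℝ := (1 / 2) ^ n * ∑ x, F x

lemma avg_add {n : ℕ} (F G : (Fin n → Fin 2) → ℝ) :
    avg (fun x => F x + G x) = avg F + avg G := by
  simp only [avg, Finset.sum_add_distrib, mul_add]

lemma avg_const_mul {n : ℕ} (c : ℝ) (F : (Fin n → Fin 2) → ℝ) :
    avg (fun x => c * F x) = c * avg F := by
  simp only [avg, ← Finset.mul_sum]; ring

lemma avg_mono {n : ℕ} {F G : (Fin n → Fin 2) → ℝ} (h : ∀ x, F x ≤ G x) : avg F ≤ avg G := by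
  unfold avg
  exact mul_le_mul_of_nonneg_left (Finset.sum_le_sum fun x _ => h x) (by positivity)

lemma avg_const {n : ℕ} (c : ℝ) : avg (fun _ : Fin n → Fin 2 => c) = c := by
  simp [avg]

lemma abs_avg_le {n : ℕ} {F : (Fin n → Fin 2) → ℝ} {c : ℝ} (h : ∀ x, |F x| ≤ c) : |avg F| ≤ c := by
  rw [abs_le]
  constructor
  · rw [← avg_const (n := n) (-c)]
    exact avg_mono fun x => (abs_le.1 (h x)).1
  · rw [← avg_const (n := n) c]
    exact avg_mono fun x => (abs_le.1 (h x)).2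

/-- Functions of disjoint sets of labels are uncorrelated. -/
lemma avg_mul_of_disjoint {n : ℕ} {F G : (Fin n → Fin 2) → ℝ} {s t : Finset (Fin n)}
    (hF : DependsOn F (s : Set (Fin n))) (hG : DependsOn G (t : Set (Fin n)))
    (hst : Disjoint s t) : avg (fun x => F x * G x) = avg F * avg G := by
  let mix : (Fin n → Fin 2) × (Fin n → Fin 2) → (Fin n → Fin 2) × (Fin n → Fin 2) :=
    fun z => (fun v => if v ∈ s then z.1 v else z.2 v, fun v => if v ∈ s then z.2 v else z.1 v)
  have hmix : Function.Involutive mix := by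
    rintro ⟨x, y⟩
    simp only [mix, Prod.mk.injEq]
    constructor <;> funext v <;> by_cases hv : v ∈ s <;> simp [hv]
  have key : (∑ x, F x) * ∑ x, G x = ∑ z : (Fin n → Fin 2) × (Fin n → Fin 2), F z.1 * G z.1 := by
    rw [Finset.sum_mul_sum, ← Finset.univ_product_univ, ← Finset.sum_product']
    simp only [Finset.univ_product_univ]
    rw [← Equiv.sum_comp (hmix.toPerm mix) (fun z => F z.1 * G z.1)]
    refine Finset.sum_congr rfl fun z _ => ?_
    congr 1
    · refine hF fun v hv => ?_
      simp [mix, Finset.mem_coe.1 hv]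
    · refine hG fun v hv => ?_
      have : v ∉ s := fun h => (Finset.disjoint_left.1 hst h) hv
      simp [mix, this]
  have key2 : ∑ z : (Fin n → Fin 2) × (Fin n → Fin 2), F z.1 * G z.1
      = 2 ^ n * ∑ x, F x * G x := by
    rw [Fintype.sum_prod_type]
    simp [Finset.mul_sum]
  unfold avg
  calc (1 / 2 : ℝ) ^ n * ∑ x, F x * G x
      = (1 / 2) ^ n * (1 / 2) ^ n * (2 ^ n * ∑ x, F x * G x) := by
        have : (1 / 2 : ℝ) ^ n * 2 ^ n = 1 := by rw [← mul_pow]; norm_num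
        linear_combination (-(1 / 2 : ℝ) ^ n * ∑ x, F x * G x) * this
    _ = (1 / 2) ^ n * (1 / 2) ^ n * ((∑ x, F x) * ∑ x, G x) := by rw [key, key2]
    _ = _ := by ring

/-- A function that does not see the label of `v` is uncorrelated with the sign of `v`. -/
lemma avg_mul_sg_eq_zero {n : ℕ} {F : (Fin n → Fin 2) → ℝ} {v : Fin n}
    (hF : DependsOn F ({v}ᶜ : Set (Fin n))) : avg (fun x => F x * sg (x v)) = 0 := by
  have h := avg_mul_of_disjoint (F := F) (G := fun x => sg (x v)) (s := {v}ᶜ) (t := {v})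
    (by simpa using hF) (fun x y hxy => congrArg sg (hxy v (by simp))) disjoint_compl_left
  rw [h]
  have : avg (fun x : Fin n → Fin 2 => sg (x v)) = 0 := by
    have hflip : ∑ x : Fin n → Fin 2, sg (x v) = ∑ x : Fin n → Fin 2, -sg (x v) := by
      rw [← Equiv.sum_comp (Equiv.arrowCongr (Equiv.refl (Fin n)) (Equiv.swap (0 : Fin 2) 1))]
      refine Finset.sum_congr rfl fun x _ => ?_
      simp [Equiv.arrowCongr, sg_swap]
    rw [Finset.sum_neg_distrib] at hflip
    have : ∑ x : Fin n → Fin 2, sg (x v) = 0 := by linarith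
    simp [avg, this]
  rw [this, mul_zero]

variable {n : ℕ}

/-- The probability that the pair `e` is an edge, given the labels. -/
noncomputable def edgeProb (a b : ℝ) (x : Fin n → Fin 2) (e : VPair n) : ℝ :=
  ssbmW 2 (a / n) (b / n) (x e.1.1) (x e.1.2)

lemma edgeProb_eq (a b : ℝ) (x : Fin n → Fin 2) (e : VPair n) :
    edgeProb a b x e = ((a + b) / 2 + (a - b) / 2 * (sg (x e.1.1) * sg (x e.1.2))) / n := by
  have h := indicator_eq (x e.1.1) (x e.1.2)
  simp only [edgeProb, ssbmW, Matrix.of_apply]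
  by_cases hx : x e.1.1 = x e.1.2
  · rw [if_pos hx] at h ⊢
    have : sg (x e.1.1) * sg (x e.1.2) = 1 := by linarith
    rw [this]; ring
  · rw [if_neg hx] at h ⊢
    have : sg (x e.1.1) * sg (x e.1.2) = -1 := by linarith
    rw [this]; ring

lemma edgeProb_mem {a b : ℝ} (x : Fin n → Fin 2) (e : VPair n) {s : Set ℝ}
    (ha : a / n ∈ s) (hb : b / n ∈ s) : edgeProb a b x e ∈ s := by
  simp only [edgeProb, ssbmW, Matrix.of_apply]
  split_ifs
  · exact ha
  · exact hb

/-- The conditional probability of a configuration of edges and coins given the labels. -/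
noncomputable def weight (a b q : ℝ) (x : Fin n → Fin 2) (h : VPair n → Bool × Bool) : ℝ :=
  ∏ e, pairWeight q (edgeProb a b x e) (h e)

/-- Expectation over labels, edges, and independent coins. -/
noncomputable def expect (a b q : ℝ)
    (F : (Fin n → Fin 2) → (VPair n → Bool × Bool) → ℝ) : ℝ :=
  avg fun x => ∑ h, weight a b q x h * F x h

lemma sum_weight (a b q : ℝ) (x : Fin n → Fin 2) : ∑ h, weight a b q x h = 1 := by
  unfold weight
  rw [← Fintype.prod_sum (fun e l => pairWeight q (edgeProb a b x e) l)]
  simp [sum_pairWeight]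

/-- The parameters for which all the weights are probabilities. -/
structure Admissible (n : ℕ) (a b q : ℝ) : Prop where
  q_nonneg : 0 ≤ q
  q_le_one : q ≤ 1
  a_mem : a / n ∈ Set.Icc (0 : ℝ) 1
  b_mem : b / n ∈ Set.Icc (0 : ℝ) 1

lemma Admissible.weight_nonneg {a b q : ℝ} (H : Admissible n a b q) (x : Fin n → Fin 2)
    (h : VPair n → Bool × Bool) : 0 ≤ weight a b q x h := by
  refine Finset.prod_nonneg fun e _ => ?_
  have := edgeProb_mem x e H.a_mem H.b_mem
  exact pairWeight_nonneg H.q_nonneg H.q_le_one this.1 this.2 _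

section expect

variable {a b q : ℝ} {F G : (Fin n → Fin 2) → (VPair n → Bool × Bool) → ℝ}

lemma expect_add : expect a b q (fun x h => F x h + G x h) = expect a b q F + expect a b q G := by
  simp only [expect, mul_add, Finset.sum_add_distrib, avg_add]

lemma expect_const_mul (c : ℝ) : expect a b q (fun x h => c * F x h) = c * expect a b q F := by
  unfold expect
  rw [← avg_const_mul]
  congr 1
  funext x
  rw [Finset.mul_sum]
  exact Finset.sum_congr rfl fun h _ => by ring

lemma expect_const (c : ℝ) :
    expect a b q (fun (_ : Fin n → Fin 2) (_ : VPair n → Bool × Bool) => c) = c := by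
  simp only [expect, ← Finset.sum_mul, sum_weight, one_mul, avg_const]

lemma expect_sum {ι : Type*} (s : Finset ι)
    (f : ι → (Fin n → Fin 2) → (VPair n → Bool × Bool) → ℝ) :
    expect a b q (fun x h => ∑ i ∈ s, f i x h) = ∑ i ∈ s, expect a b q (f i) := by
  induction s using Finset.induction_on with
  | empty => simpa using expect_const (n := n) (a := a) (b := b) (q := q) 0
  | insert i s hi ih =>
    simp only [Finset.sum_insert hi]
    rw [expect_add, ih]

lemma expect_mono (H : Admissible n a b q) (h : ∀ x h, F x h ≤ G x h) :
    expect a b q F ≤ expect a b q G :=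
  avg_mono fun x => Finset.sum_le_sum fun g _ =>
    mul_le_mul_of_nonneg_left (h x g) (H.weight_nonneg x g)

lemma expect_sq_sub (Y : (Fin n → Fin 2) → (VPair n → Bool × Bool) → ℝ) :
    expect a b q (fun x h => (Y x h - expect a b q Y) ^ 2) =
      expect a b q (fun x h => Y x h * Y x h) - expect a b q Y * expect a b q Y := by
  set m := expect a b q Y with hm
  have : (fun (x : Fin n → Fin 2) (h : VPair n → Bool × Bool) => (Y x h - m) ^ 2) =
      fun x h => Y x h * Y x h + ((-2 * m) * Y x h + m * m) := by
    funext x h; ring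
  rw [this, expect_add, expect_add, expect_const_mul, expect_const, ← hm]
  ring

end expect

/-- The edge density of the first layer, as a function on unordered pairs. -/
noncomputable def link (d s : ℝ) (x : Fin n → Fin 2) : Sym2 (Fin n) → ℝ :=
  Sym2.lift ⟨fun u v => (d + s * (sg (x u) * sg (x v))) / n,
    fun u v => by simp only [mul_comm (sg (x u))]⟩

@[simp] lemma link_mk (d s : ℝ) (x : Fin n → Fin 2) (u v : Fin n) :
    link d s x s(u, v) = (d + s * (sg (x u) * sg (x v))) / n := rfl

lemma link_mem {d s D : ℝ} (hs : |s| ≤ d) (hD : d + |s| ≤ D) (x : Fin n → Fin 2)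
    (p : Sym2 (Fin n)) : link d s x p ∈ Set.Icc 0 (D / n) := by
  induction p using Sym2.ind with
  | _ u v =>
    rw [link_mk]
    have h1 : |s * (sg (x u) * sg (x v))| = |s| := by simp [abs_mul, abs_sg]
    have h2 := abs_le.1 h1.le
    constructor
    · exact div_nonneg (by linarith) (Nat.cast_nonneg n)
    · exact div_le_div_of_nonneg_right (by linarith) (Nat.cast_nonneg n)

lemma dependsOn_prod_link (d s : ℝ) {E : Finset (Sym2 (Fin n))} {V : Finset (Fin n)}
    (hE : ∀ p ∈ E, ∀ v ∈ p, v ∈ V) :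
    DependsOn (fun x : Fin n → Fin 2 => ∏ p ∈ E, link d s x p) (V : Set (Fin n)) := by
  intro x y hxy
  refine Finset.prod_congr rfl fun p hp => ?_
  have := hE p hp
  induction p using Sym2.ind with
  | _ u v =>
    rw [link_mk, link_mk, hxy u (this u (by simp)), hxy v (this v (by simp))]

/-- All the pairs in `S` are edges of `g`. -/
def Kept (g : VPair n → Bool) (S : Finset (Sym2 (Fin n))) : Prop :=
  ∀ e : VPair n, s(e.1.1, e.1.2) ∈ S → g e = true

lemma kept_union (g : VPair n → Bool) (S T : Finset (Sym2 (Fin n))) :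
    Kept g (S ∪ T) ↔ Kept g S ∧ Kept g T := by
  simp only [Kept, Finset.mem_union]
  exact ⟨fun h => ⟨fun e he => h e (Or.inl he), fun e he => h e (Or.inr he)⟩,
    fun h e he => he.elim (h.1 e) (h.2 e)⟩

/-- The first layer of a configuration. -/
def layer (h : VPair n → Bool × Bool) : VPair n → Bool := fun e => fstLayer (h e)

lemma prod_edges_eq {S : Finset (Sym2 (Fin n))} (hS : ∀ p ∈ S, ¬p.IsDiag) (f : Sym2 (Fin n) → ℝ) :
    ∏ e : VPair n, (if s(e.1.1, e.1.2) ∈ S then f s(e.1.1, e.1.2) else 1) = ∏ p ∈ S, f p := by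
  rw [← Finset.prod_filter]
  refine Finset.prod_bij (fun e _ => s(e.1.1, e.1.2)) ?_ ?_ ?_ ?_
  · intro e he
    exact (Finset.mem_filter.1 he).2
  · rintro ⟨⟨u, v⟩, huv⟩ _ ⟨⟨u', v'⟩, huv'⟩ _ h
    simp only [Sym2.eq_iff] at h
    simp only at huv huv'
    rcases h with ⟨rfl, rfl⟩ | ⟨rfl, rfl⟩
    · rfl
    · exact absurd huv (not_lt.2 huv'.le)
  · intro p hp
    have hd := hS p hp
    induction p using Sym2.ind with
    | _ u v =>
      rw [Sym2.mk_isDiag_iff] at hd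
      rcases lt_or_gt_of_ne hd with h | h
      · exact ⟨⟨(u, v), h⟩, by simpa using hp, rfl⟩
      · exact ⟨⟨(v, u), h⟩, by simpa [Sym2.eq_swap] using hp, Sym2.eq_swap⟩
  · intro e _
    rfl

lemma sum_weight_kept (a b q : ℝ) (x : Fin n → Fin 2) {S : Finset (Sym2 (Fin n))}
    (hS : ∀ p ∈ S, ¬p.IsDiag) :
    ∑ h, weight a b q x h * (if Kept (layer h) S then 1 else 0) =
      ∏ p ∈ S, link ((1 - q) * ((a + b) / 2)) ((1 - q) * ((a - b) / 2)) x p := by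
  rw [← prod_edges_eq hS]
  have h1 : ∀ h : VPair n → Bool × Bool,
      weight a b q x h * (if Kept (layer h) S then 1 else 0) =
      ∏ e, pairWeight q (edgeProb a b x e) (h e) *
        (if s(e.1.1, e.1.2) ∈ S then (if fstLayer (h e) = true then 1 else 0) else 1) := by
    intro h
    rw [Finset.prod_mul_distrib, weight]
    congr 1
    by_cases hk : Kept (layer h) S
    · rw [if_pos hk]
      refine (Finset.prod_eq_one fun e _ => ?_).symm
      split_ifs with h1 h2
      · rfl
      · exact absurd (hk e h1) h2
      · rfl
    · rw [if_neg hk]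
      simp only [Kept, not_forall] at hk
      obtain ⟨e, he, hne⟩ := hk
      refine (Finset.prod_eq_zero (Finset.mem_univ e) ?_).symm
      rw [if_pos he]; exact if_neg hne
  simp_rw [h1]
  rw [← Fintype.prod_sum (fun (e : VPair n) l => pairWeight q (edgeProb a b x e) l *
        (if s(e.1.1, e.1.2) ∈ S then (if fstLayer l = true then (1 : ℝ) else 0) else 1))]
  refine Finset.prod_congr rfl fun e _ => ?_
  split_ifs with he
  · rw [sum_pairWeight_fstLayer, edgeProb_eq, link_mk]
    ring
  · simp [sum_pairWeight]

lemma expect_kept (a b q : ℝ) (c : (Fin n → Fin 2) → ℝ) {S : Finset (Sym2 (Fin n))}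
    (hS : ∀ p ∈ S, ¬p.IsDiag) :
    expect a b q (fun x h => c x * (if Kept (layer h) S then 1 else 0)) =
      avg fun x => c x *
        ∏ p ∈ S, link ((1 - q) * ((a + b) / 2)) ((1 - q) * ((a - b) / 2)) x p := by
  unfold expect
  congr 1
  funext x
  rw [← sum_weight_kept a b q x hS, Finset.mul_sum]
  exact Finset.sum_congr rfl fun h _ => by ring

lemma abs_avg_mul_prod_link_le {d s D : ℝ} (hs : |s| ≤ d) (hD : d + |s| ≤ D)
    {c : (Fin n → Fin 2) → ℝ} (hc : ∀ x, |c x| ≤ 1) (S : Finset (Sym2 (Fin n))) :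
    |avg fun x => c x * ∏ p ∈ S, link d s x p| ≤ (D / n) ^ S.card := by
  refine abs_avg_le fun x => ?_
  rw [abs_mul]
  have h1 : |∏ p ∈ S, link d s x p| ≤ (D / n) ^ S.card := by
    rw [Finset.abs_prod, ← Finset.prod_const]
    refine Finset.prod_le_prod (fun p _ => abs_nonneg _) fun p _ => ?_
    have := link_mem hs hD x p
    rw [abs_of_nonneg this.1]
    exact this.2
  calc |c x| * |∏ p ∈ S, link d s x p| ≤ 1 * (D / n) ^ S.card :=
        mul_le_mul (hc x) h1 (abs_nonneg _) zero_le_one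
    _ = _ := one_mul _

/-- A connected set of vertices has at most one more vertex than edges. -/
lemma card_le_of_reachable {S : Finset (Sym2 (Fin n))} {V : Finset (Fin n)}
    (hV : ∀ u ∈ V, ∀ v ∈ V, (SimpleGraph.fromEdgeSet (S : Set (Sym2 (Fin n)))).Reachable u v) :
    V.card ≤ S.card + 1 := by
  rcases V.eq_empty_or_nonempty with rfl | ⟨u, hu⟩
  · simp
  set G := SimpleGraph.fromEdgeSet (S : Set (Sym2 (Fin n))) with hG
  let C := G.connectedComponentMk u
  have hC := C.connected_toSimpleGraph.card_vert_le_card_edgeSet_add_one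
  have h1 : V.card ≤ Nat.card C := by
    rw [← Fintype.card_coe V, ← Nat.card_eq_fintype_card]
    refine Nat.card_le_card_of_injective (fun v : V => (⟨v.1, ?_⟩ : C)) ?_
    · exact SimpleGraph.ConnectedComponent.sound (hV v.1 v.2 u hu)
    · intro v w hvw
      have := congrArg (fun z : C => z.1) hvw
      exact Subtype.ext this
  have h2 : Nat.card C.toSimpleGraph.edgeSet ≤ S.card := by
    rw [← Fintype.card_coe S, ← Nat.card_eq_fintype_card]
    refine Nat.card_le_card_of_injective
      (fun p : C.toSimpleGraph.edgeSet => (⟨Sym2.map Subtype.val p.1, ?_⟩ : S)) ?_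
    · obtain ⟨p, hp⟩ := p
      induction p using Sym2.ind with
      | _ v w =>
        rw [SimpleGraph.mem_edgeSet] at hp
        have := C.toSimpleGraph_hom.map_adj hp
        exact_mod_cast ((SimpleGraph.fromEdgeSet_adj _).1 this).1
    · intro p p' hpp
      exact Subtype.ext (Sym2.map.injective Subtype.val_injective (congrArg (fun z : S => z.1) hpp))
  omega

/-- A connected sum of local observables has variance of linear order, as soon as the
configurations are counted correctly. -/
lemma variance_le {κ : Type*} (J : Finset κ) (V : κ → Finset (Fin n))
    (E : κ → Finset (Sym2 (Fin n))) (c : κ → (Fin n → Fin 2) → ℝ) {a b q D : ℝ} {M : ℕ}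
    (hs : |(1 - q) * ((a - b) / 2)| ≤ (1 - q) * ((a + b) / 2))
    (hD : (1 - q) * ((a + b) / 2) + |(1 - q) * ((a - b) / 2)| ≤ D) (hD1 : 1 ≤ D) (hDn : D ≤ n)
    (hdiag : ∀ j ∈ J, ∀ p ∈ E j, ¬p.IsDiag) (hE : ∀ j ∈ J, ∀ p ∈ E j, ∀ v ∈ p, v ∈ V j)
    (hconn : ∀ j ∈ J, ∀ u ∈ V j, ∀ v ∈ V j,
      (SimpleGraph.fromEdgeSet (E j : Set (Sym2 (Fin n)))).Reachable u v)
    (hc : ∀ j ∈ J, DependsOn (c j) (V j : Set (Fin n))) (hc1 : ∀ j ∈ J, ∀ x, |c j x| ≤ 1)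
    (hM : ∀ j ∈ J, (V j).card ≤ M) {Y : (Fin n → Fin 2) → (VPair n → Bool × Bool) → ℝ}
    (hY : ∀ x h, Y x h = ∑ j ∈ J, c j x * (if Kept (layer h) (E j) then 1 else 0)) :
    expect a b q (fun x h => (Y x h - expect a b q Y) ^ 2) ≤
      2 * n * D ^ (2 * M) * ∑ j ∈ J, ∑ k ∈ J, (1 / (n : ℝ)) ^ (V j ∪ V k).card := by
  have hn : (0 : ℝ) < n := by linarith
  have hDn1 : D / n ≤ 1 := (div_le_one hn).2 hDn
  have hDn0 : 0 ≤ D / n := by positivity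
  obtain rfl : Y = fun x h => ∑ j ∈ J, c j x * (if Kept (layer h) (E j) then 1 else 0) := by
    funext x h; exact hY x h
  rw [expect_sq_sub]
  set d := (1 - q) * ((a + b) / 2)
  set s := (1 - q) * ((a - b) / 2)
  set T : κ → (Fin n → Fin 2) → (VPair n → Bool × Bool) → ℝ :=
    fun j x h => c j x * (if Kept (layer h) (E j) then 1 else 0) with hT
  have hdiag2 : ∀ j ∈ J, ∀ k ∈ J, ∀ p ∈ E j ∪ E k, ¬p.IsDiag := by
    intro j hj k hk p hp
    rcases Finset.mem_union.1 hp with h | h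
    · exact hdiag j hj p h
    · exact hdiag k hk p h
  have hTT : ∀ j ∈ J, ∀ k ∈ J, expect a b q (fun x h => T j x h * T k x h) =
      avg fun x => (c j x * c k x) * ∏ p ∈ E j ∪ E k, link d s x p := by
    intro j hj k hk
    rw [← expect_kept a b q _ (hdiag2 j hj k hk)]
    congr 1
    funext x h
    simp only [hT, kept_union]
    by_cases h1 : Kept (layer h) (E j) <;> by_cases h2 : Kept (layer h) (E k) <;> simp [h1, h2]
  have hT1 : ∀ j ∈ J, expect a b q (T j) = avg fun x => c j x * ∏ p ∈ E j, link d s x p := by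
    intro j hj
    exact expect_kept a b q _ (hdiag j hj)
  have hYY : expect a b q (fun x h => (∑ j ∈ J, T j x h) * ∑ j ∈ J, T j x h) =
      ∑ j ∈ J, ∑ k ∈ J, expect a b q (fun x h => T j x h * T k x h) := by
    simp_rw [Finset.sum_mul_sum]
    rw [expect_sum]
    exact Finset.sum_congr rfl fun j _ => expect_sum _ _
  have hYm : expect a b q (fun x h => ∑ j ∈ J, T j x h) * expect a b q (fun x h => ∑ j ∈ J, T j x h)
      = ∑ j ∈ J, ∑ k ∈ J, expect a b q (T j) * expect a b q (T k) := by
    rw [expect_sum, Finset.sum_mul_sum]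
  rw [hYY, hYm, ← Finset.sum_sub_distrib, Finset.mul_sum]
  refine Finset.sum_le_sum fun j hj => ?_
  rw [← Finset.sum_sub_distrib, Finset.mul_sum]
  refine Finset.sum_le_sum fun k hk => ?_
  rw [hTT j hj k hk, hT1 j hj, hT1 k hk]
  by_cases hdis : Disjoint (V j) (V k)
  · have hEd : Disjoint (E j) (E k) := by
      rw [Finset.disjoint_left]
      intro p hpj hpk
      induction p using Sym2.ind with
      | _ u v =>
        exact Finset.disjoint_left.1 hdis (hE j hj _ hpj u (by simp)) (hE k hk _ hpk u (by simp))
    have hdep : ∀ i ∈ J, DependsOn (fun x => c i x * ∏ p ∈ E i, link d s x p)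
        (V i : Set (Fin n)) := by
      intro i hi x y hxy
      exact congrArg₂ (· * ·) (hc i hi hxy) (dependsOn_prod_link d s (hE i hi) hxy)
    have := avg_mul_of_disjoint (hdep j hj) (hdep k hk) hdis
    rw [← this]
    have h0 : ∀ x : Fin n → Fin 2, c j x * c k x * ∏ p ∈ E j ∪ E k, link d s x p =
        (c j x * ∏ p ∈ E j, link d s x p) * (c k x * ∏ p ∈ E k, link d s x p) := by
      intro x
      rw [Finset.prod_union hEd]
      ring
    simp_rw [h0]
    rw [sub_self]
    positivity
  · have hcard : (V j ∪ V k).card ≤ (E j ∪ E k).card + 1 := by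
      obtain ⟨w, hwj, hwk⟩ := Finset.not_disjoint_iff.1 hdis
      apply card_le_of_reachable
      have hw : ∀ u ∈ V j ∪ V k, (SimpleGraph.fromEdgeSet
          ((E j ∪ E k : Finset (Sym2 (Fin n))) : Set (Sym2 (Fin n)))).Reachable u w := by
        intro u hu
        rcases Finset.mem_union.1 hu with h | h
        · exact (hconn j hj u h w hwj).mono (SimpleGraph.fromEdgeSet_mono (by simp))
        · exact (hconn k hk u h w hwk).mono (SimpleGraph.fromEdgeSet_mono (by simp))
      exact fun u hu v hv => (hw u hu).trans (hw v hv).symm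
    have hpos : 0 < (V j ∪ V k).card := by
      obtain ⟨w, hwj, _⟩ := Finset.not_disjoint_iff.1 hdis
      exact Finset.card_pos.2 ⟨w, Finset.mem_union_left _ hwj⟩
    have hVM : (V j ∪ V k).card ≤ 2 * M := by
      have := Finset.card_union_le (V j) (V k)
      have := hM j hj
      have := hM k hk
      omega
    have hbound : ∀ m : ℕ, (V j ∪ V k).card ≤ m + 1 →
        (D / n) ^ m ≤ n * D ^ (2 * M) * (1 / (n : ℝ)) ^ (V j ∪ V k).card := by
      intro m hm
      obtain ⟨l, hl⟩ := Nat.exists_eq_succ_of_ne_zero hpos.ne'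
      rw [hl] at hm hVM ⊢
      calc (D / n) ^ m ≤ (D / n) ^ l := pow_le_pow_of_le_one hDn0 hDn1 (by omega)
        _ = n * D ^ l * (1 / (n : ℝ)) ^ (l + 1) := by
          rw [div_pow, div_pow, one_pow, pow_succ]
          field_simp
        _ ≤ _ := by
          gcongr
          omega
    have h1 := abs_avg_mul_prod_link_le hs hD (c := fun x => c j x * c k x) (fun x => by
      rw [abs_mul]; exact mul_le_one₀ (hc1 j hj x) (abs_nonneg _) (hc1 k hk x)) (E j ∪ E k)
    have h2 := abs_avg_mul_prod_link_le hs hD (c := c j) (hc1 j hj) (E j)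
    have h3 := abs_avg_mul_prod_link_le hs hD (c := c k) (hc1 k hk) (E k)
    have h4 := hbound _ hcard
    have h5 := hbound ((E j).card + (E k).card) (by
      have := Finset.card_union_le (E j) (E k)
      omega)
    rw [pow_add] at h5
    have h6 := mul_le_mul h2 h3 (abs_nonneg _) (by positivity)
    rw [← abs_mul] at h6
    have h7 := (abs_le.1 h1).2
    have h8 := (abs_le.1 h6).1
    linarith

section Path

variable {V : Type*}

lemma edge_injOn {α : ℕ → V} {r : ℕ} (hα : Set.InjOn α (Set.Iic r)) :
    Set.InjOn (fun k => s(α k, α (k + 1))) (Set.Iio r) := by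
  intro k hk l hl h
  simp only [Set.mem_Iio] at hk hl
  rcases Sym2.eq_iff.1 h with ⟨h1, _⟩ | ⟨h1, h2⟩
  · exact hα (Set.mem_Iic.2 hk.le) (Set.mem_Iic.2 hl.le) h1
  · have := hα (Set.mem_Iic.2 hk.le) (Set.mem_Iic.2 hl) h1
    have := hα (Set.mem_Iic.2 hk) (Set.mem_Iic.2 hl.le) h2
    omega

variable [DecidableEq V]

/-- The edges of the path `α 0, …, α r`. -/
noncomputable def pathEdges (α : ℕ → V) (r : ℕ) : Finset (Sym2 V) :=
  (Finset.range r).image fun k => s(α k, α (k + 1))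

/-- The vertices of the path `α 0, …, α r`. -/
noncomputable def pathVerts (α : ℕ → V) (r : ℕ) : Finset V :=
  (Finset.range (r + 1)).image α

lemma mem_pathVerts {α : ℕ → V} {r k : ℕ} (hk : k ≤ r) : α k ∈ pathVerts α r :=
  Finset.mem_image_of_mem _ (Finset.mem_range.2 (by omega))

lemma exists_of_mem_pathVerts {α : ℕ → V} {r : ℕ} {v : V} (hv : v ∈ pathVerts α r) :
    ∃ k ≤ r, α k = v := by
  obtain ⟨k, hk, rfl⟩ := Finset.mem_image.1 hv
  exact ⟨k, by have := Finset.mem_range.1 hk; omega, rfl⟩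

lemma mem_pathEdges {α : ℕ → V} {r k : ℕ} (hk : k < r) : s(α k, α (k + 1)) ∈ pathEdges α r :=
  Finset.mem_image_of_mem _ (Finset.mem_range.2 hk)

lemma exists_of_mem_pathEdges {α : ℕ → V} {r : ℕ} {p : Sym2 V} (hp : p ∈ pathEdges α r) :
    ∃ k < r, s(α k, α (k + 1)) = p := by
  obtain ⟨k, hk, rfl⟩ := Finset.mem_image.1 hp
  exact ⟨k, Finset.mem_range.1 hk, rfl⟩

lemma card_pathVerts_le (α : ℕ → V) (r : ℕ) : (pathVerts α r).card ≤ r + 1 :=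
  Finset.card_image_le.trans (by simp)

lemma mem_pathVerts_of_mem {α : ℕ → V} {r : ℕ} {p : Sym2 V} (hp : p ∈ pathEdges α r) {v : V}
    (hv : v ∈ p) : v ∈ pathVerts α r := by
  obtain ⟨k, hk, rfl⟩ := exists_of_mem_pathEdges hp
  rcases Sym2.mem_iff.1 hv with rfl | rfl
  · exact mem_pathVerts hk.le
  · exact mem_pathVerts hk

lemma not_isDiag_of_mem_pathEdges {α : ℕ → V} {r : ℕ} (hα : Set.InjOn α (Set.Iic r)) {p : Sym2 V}
    (hp : p ∈ pathEdges α r) : ¬p.IsDiag := by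
  obtain ⟨k, hk, rfl⟩ := exists_of_mem_pathEdges hp
  rw [Sym2.mk_isDiag_iff]
  intro h
  have := hα (Set.mem_Iic.2 hk.le) (Set.mem_Iic.2 hk) h
  omega

lemma reachable_of_mem_pathVerts {α : ℕ → V} {r : ℕ} {u v : V} (hu : u ∈ pathVerts α r)
    (hv : v ∈ pathVerts α r) :
    (SimpleGraph.fromEdgeSet (pathEdges α r : Set (Sym2 V))).Reachable u v := by
  have key : ∀ k ≤ r, (SimpleGraph.fromEdgeSet (pathEdges α r : Set (Sym2 V))).Reachable
      (α 0) (α k) := by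
    intro k
    induction k with
    | zero => exact fun _ => SimpleGraph.Reachable.refl _
    | succ k ih =>
      intro hk
      refine (ih (by omega)).trans ?_
      by_cases h : α k = α (k + 1)
      · rw [h]
      · refine SimpleGraph.Adj.reachable ((SimpleGraph.fromEdgeSet_adj _).2 ⟨?_, h⟩)
        exact_mod_cast mem_pathEdges (by omega)
  obtain ⟨k, hk, rfl⟩ := exists_of_mem_pathVerts hu
  obtain ⟨l, hl, rfl⟩ := exists_of_mem_pathVerts hv
  exact (key k hk).symm.trans (key l hl)

lemma prod_pathEdges {α : ℕ → V} {r : ℕ} (hα : Set.InjOn α (Set.Iic r)) (f : Sym2 V → ℝ) :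
    ∏ p ∈ pathEdges α r, f p = ∏ k ∈ Finset.range r, f s(α k, α (k + 1)) := by
  unfold pathEdges
  refine Finset.prod_image fun k hk l hl h => edge_injOn hα ?_ ?_ h
  · simpa using hk
  · simpa using hl

/-- `β` follows `α` up to time `t` and avoids `α` from then on. -/
def Branches (α β : ℕ → V) (r t : ℕ) : Prop :=
  (∀ i ≤ t, β i = α i) ∧ ∀ i, t < i → i ≤ r → β i ∉ pathVerts α r

lemma prod_union_of_branches {α β : ℕ → V} {r t : ℕ} (hα : Set.InjOn α (Set.Iic r))
    (hβ : Set.InjOn β (Set.Iic r)) (h : Branches α β r t) (f : Sym2 V → ℝ) :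
    ∏ p ∈ pathEdges α r ∪ pathEdges β r, f p =
      (∏ k ∈ Finset.Ico 0 r, f s(α k, α (k + 1))) * ∏ k ∈ Finset.Ico t r, f s(β k, β (k + 1)) := by
  have hE : pathEdges α r ∪ pathEdges β r =
      pathEdges α r ∪ (Finset.Ico t r).image fun k => s(β k, β (k + 1)) := by
    ext p
    simp only [Finset.mem_union]
    constructor
    · rintro (hp | hp)
      · exact Or.inl hp
      · obtain ⟨k, hk, rfl⟩ := exists_of_mem_pathEdges hp
        by_cases hkt : k < t
        · left
          rw [h.1 k hkt.le, h.1 (k + 1) hkt]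
          exact mem_pathEdges hk
        · exact Or.inr (Finset.mem_image_of_mem _ (Finset.mem_Ico.2 ⟨by omega, hk⟩))
    · rintro (hp | hp)
      · exact Or.inl hp
      · obtain ⟨k, hk, rfl⟩ := Finset.mem_image.1 hp
        exact Or.inr (mem_pathEdges (Finset.mem_Ico.1 hk).2)
  rw [hE, Finset.prod_union, prod_pathEdges hα, Finset.range_eq_Ico]
  · congr 1
    refine Finset.prod_image fun k hk l hl h => edge_injOn hβ ?_ ?_ h
    · simpa using (Finset.mem_Ico.1 hk).2
    · simpa using (Finset.mem_Ico.1 hl).2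
  · rw [Finset.disjoint_right]
    intro p hp hp'
    obtain ⟨k, hk, rfl⟩ := Finset.mem_image.1 hp
    have hk := Finset.mem_Ico.1 hk
    exact h.2 (k + 1) (by omega) (by omega) (mem_pathVerts_of_mem hp' (by simp))

/-- Two self-avoiding paths from the same vertex, if they do not branch at some time, span a
subgraph with a cycle. -/
lemma card_le_of_not_branches {α β : ℕ → V} {r : ℕ} (hα : Set.InjOn α (Set.Iic r))
    (hβ : Set.InjOn β (Set.Iic r)) (h0 : α 0 = β 0) (h : ∀ t ≤ r, ¬Branches α β r t) :
    (pathVerts α r ∪ pathVerts β r).card ≤ (pathEdges α r ∪ pathEdges β r).card := by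
  -- a step of `β` into `α` that is not an edge of `α`
  have hext : ∃ i < r, s(β i, β (i + 1)) ∉ pathEdges α r ∧ β (i + 1) ∈ pathVerts α r := by
    by_contra! hno
    -- then `β i ∈ α` forces equality so far
    have hC : ∀ i ≤ r, β i ∈ pathVerts α r → ∀ j ≤ i, β j = α j := by
      intro i
      induction i with
      | zero =>
        intro _ _ j hj
        obtain rfl : j = 0 := by omega
        exact h0.symm
      | succ i ih =>
        intro hi hmem
        have hedge : s(β i, β (i + 1)) ∈ pathEdges α r := by
          by_contra hne
          exact hno i (by omega) hne hmem
        have hprev := ih (by omega) (mem_pathVerts_of_mem hedge (by simp))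
        obtain ⟨k, hk, hke⟩ := exists_of_mem_pathEdges hedge
        have hlast : β (i + 1) = α (i + 1) := by
          rcases Sym2.eq_iff.1 hke with ⟨h1, h2⟩ | ⟨h1, h2⟩
          · rw [hprev i le_rfl] at h1
            have := hα (Set.mem_Iic.2 hk.le) (Set.mem_Iic.2 (by omega)) h1
            rw [← h2, this]
          · rw [hprev i le_rfl] at h2
            have hki := hα (Set.mem_Iic.2 hk) (Set.mem_Iic.2 (by omega)) h2
            rw [← hprev k (by omega)] at h1
            have := hβ (Set.mem_Iic.2 (by omega)) (Set.mem_Iic.2 (by omega)) h1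
            omega
        intro j hj
        rcases Nat.lt_or_ge j (i + 1) with h' | h'
        · exact hprev j (by omega)
        · obtain rfl : j = i + 1 := by omega
          exact hlast
    have hne : ((Finset.range (r + 1)).filter fun i => β i ∈ pathVerts α r).Nonempty :=
      ⟨0, by simp [← h0, mem_pathVerts]⟩
    set t := Finset.max' _ hne with htdef
    have htm := Finset.max'_mem _ hne
    rw [← htdef, Finset.mem_filter, Finset.mem_range] at htm
    refine h t (by omega) ⟨hC t (by omega) htm.2, fun i hti hir hmem => ?_⟩
    have hi : i ∈ (Finset.range (r + 1)).filter fun i => β i ∈ pathVerts α r :=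
      Finset.mem_filter.2 ⟨Finset.mem_range.2 (by omega), hmem⟩
    have := Finset.le_max' _ i hi
    omega
  obtain ⟨i₀, hi₀, hne, hmem⟩ := hext
  set B := (Finset.range r).filter fun i => β (i + 1) ∉ pathVerts α r with hB
  have hV : pathVerts α r ∪ pathVerts β r = pathVerts α r ∪ B.image fun i => β (i + 1) := by
    ext v
    simp only [Finset.mem_union]
    constructor
    · rintro (hv | hv)
      · exact Or.inl hv
      · obtain ⟨k, hk, rfl⟩ := exists_of_mem_pathVerts hv
        by_cases hm : β k ∈ pathVerts α r
        · exact Or.inl hm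
        · right
          obtain ⟨l, rfl⟩ : ∃ l, k = l + 1 := Nat.exists_eq_succ_of_ne_zero (by
            rintro rfl
            exact hm (h0 ▸ mem_pathVerts (Nat.zero_le r)))
          exact Finset.mem_image.2 ⟨l, Finset.mem_filter.2 ⟨Finset.mem_range.2 (by omega), hm⟩, rfl⟩
    · rintro (hv | hv)
      · exact Or.inl hv
      · obtain ⟨l, hl, rfl⟩ := Finset.mem_image.1 hv
        have := Finset.mem_range.1 (Finset.mem_filter.1 hl).1
        exact Or.inr (mem_pathVerts (by omega))
  have hi₀B : i₀ ∉ B := fun hh => (Finset.mem_filter.1 hh).2 hmem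
  have hEle : (pathEdges α r).card + (B.card + 1) ≤ (pathEdges α r ∪ pathEdges β r).card := by
    rw [← Finset.card_insert_of_notMem hi₀B]
    have hinj : Set.InjOn (fun k => s(β k, β (k + 1))) (insert i₀ B : Finset ℕ) := by
      refine (edge_injOn hβ).mono fun k hk => ?_
      rcases Finset.mem_insert.1 hk with rfl | hk
      · exact hi₀
      · exact Finset.mem_range.1 (Finset.mem_filter.1 hk).1
    rw [← Finset.card_image_of_injOn hinj, ← Finset.card_union_of_disjoint]
    · refine Finset.card_le_card (Finset.union_subset_union_right fun p hp => ?_)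
      obtain ⟨k, hk, rfl⟩ := Finset.mem_image.1 hp
      rcases Finset.mem_insert.1 hk with rfl | hk
      · exact mem_pathEdges hi₀
      · exact mem_pathEdges (Finset.mem_range.1 (Finset.mem_filter.1 hk).1)
    · rw [Finset.disjoint_right]
      intro p hp
      obtain ⟨k, hk, rfl⟩ := Finset.mem_image.1 hp
      rcases Finset.mem_insert.1 hk with rfl | hk
      · exact hne
      · exact fun hh => (Finset.mem_filter.1 hk).2 (mem_pathVerts_of_mem hh (by simp))
  have hEα : (pathEdges α r).card = r := by
    unfold pathEdges
    rw [Finset.card_image_of_injOn, Finset.card_range]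
    exact fun k hk l hl h => edge_injOn hα (by simpa using hk) (by simpa using hl) h
  have h1 := card_pathVerts_le α r
  have h2 := Finset.card_union_le (pathVerts α r) (B.image fun i => β (i + 1))
  have h3 : (B.image fun i => β (i + 1)).card ≤ B.card := Finset.card_image_le
  rw [hV]
  omega

end Path

/-- Averaging out the far end of a path, with a sign at that end. -/
lemma avg_peel_sg (d s : ℝ) {α : ℕ → Fin n} {i j : ℕ} (hij : i ≤ j)
    (hα : Set.InjOn α (Set.Icc i j)) {G : (Fin n → Fin 2) → ℝ}
    (hG : ∀ k, i < k → k ≤ j → DependsOn G ({α k}ᶜ : Set (Fin n))) :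
    avg (fun x => G x * sg (x (α j)) * ∏ k ∈ Finset.Ico i j, link d s x s(α k, α (k + 1))) =
      (s / n) ^ (j - i) * avg fun x => G x * sg (x (α i)) := by
  induction j, hij using Nat.le_induction with
  | base => simp
  | succ j hij ih =>
    have hne : ∀ k, i ≤ k → k ≤ j → α k ≠ α (j + 1) := by
      intro k hk hkj hh
      have := hα ⟨hk, by omega⟩ ⟨by omega, le_rfl⟩ hh
      omega
    have ih' := ih (hα.mono (Set.Icc_subset_Icc_right (by omega)))
      (fun k hk hkj => hG k hk (by omega))
    rw [show j + 1 - i = (j - i) + 1 by omega, pow_succ, mul_assoc, mul_comm (s / n), ← mul_assoc,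
      ← ih', mul_comm _ (s / n), ← avg_const_mul]
    have hz := avg_mul_sg_eq_zero (v := α (j + 1)) (F := fun x => d / n * (G x *
      ∏ k ∈ Finset.Ico i j, link d s x s(α k, α (k + 1)))) (by
        intro x y hxy
        have h1 : G x = G y := hG (j + 1) (by omega) le_rfl hxy
        have h2 : ∏ k ∈ Finset.Ico i j, link d s x s(α k, α (k + 1)) =
            ∏ k ∈ Finset.Ico i j, link d s y s(α k, α (k + 1)) := by
          refine Finset.prod_congr rfl fun k hk => ?_
          have hk := Finset.mem_Ico.1 hk
          rw [link_mk, link_mk, hxy (α k) (by simpa using hne k hk.1 (by omega)),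
            hxy (α (k + 1)) (by simpa using hne (k + 1) (by omega) (by omega))]
        simp only [h1, h2])
    conv_rhs => rw [← add_zero (avg _), ← hz, ← avg_add]
    congr 1
    funext x
    rw [Finset.prod_Ico_succ_top (by omega), link_mk]
    have := sg_mul_self (x (α (j + 1)))
    linear_combination (s / n * G x * sg (x (α j)) *
      ∏ k ∈ Finset.Ico i j, link d s x s(α k, α (k + 1))) * this

/-- Averaging out the far end of a path. -/
lemma avg_peel (d s : ℝ) {α : ℕ → Fin n} {i j : ℕ} (hij : i ≤ j)
    (hα : Set.InjOn α (Set.Icc i j)) {G : (Fin n → Fin 2) → ℝ}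
    (hG : ∀ k, i < k → k ≤ j → DependsOn G ({α k}ᶜ : Set (Fin n))) :
    avg (fun x => G x * ∏ k ∈ Finset.Ico i j, link d s x s(α k, α (k + 1))) =
      (d / n) ^ (j - i) * avg G := by
  induction j, hij using Nat.le_induction with
  | base => simp
  | succ j hij ih =>
    have hne : ∀ k, i ≤ k → k ≤ j → α k ≠ α (j + 1) := by
      intro k hk hkj hh
      have := hα ⟨hk, by omega⟩ ⟨by omega, le_rfl⟩ hh
      omega
    have ih' := ih (hα.mono (Set.Icc_subset_Icc_right (by omega)))
      (fun k hk hkj => hG k hk (by omega))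
    rw [show j + 1 - i = (j - i) + 1 by omega, pow_succ, mul_assoc, mul_comm (d / n), ← mul_assoc,
      ← ih', mul_comm _ (d / n), ← avg_const_mul]
    have hz := avg_mul_sg_eq_zero (v := α (j + 1)) (F := fun x => s / n * (G x * sg (x (α j)) *
      ∏ k ∈ Finset.Ico i j, link d s x s(α k, α (k + 1)))) (by
        intro x y hxy
        have h1 : G x = G y := hG (j + 1) (by omega) le_rfl hxy
        have h2 : ∏ k ∈ Finset.Ico i j, link d s x s(α k, α (k + 1)) =
            ∏ k ∈ Finset.Ico i j, link d s y s(α k, α (k + 1)) := by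
          refine Finset.prod_congr rfl fun k hk => ?_
          have hk := Finset.mem_Ico.1 hk
          rw [link_mk, link_mk, hxy (α k) (by simpa using hne k hk.1 (by omega)),
            hxy (α (k + 1)) (by simpa using hne (k + 1) (by omega) (by omega))]
        simp only [h1, h2, hxy (α j) (by simpa using hne j hij le_rfl)])
    conv_rhs => rw [← add_zero (avg _), ← hz, ← avg_add]
    congr 1
    funext x
    rw [Finset.prod_Ico_succ_top (by omega), link_mk]
    ring

/-- Configurations, weighted according to the number of vertices they occupy, are bounded in
number. -/
lemma sum_pow_card_image_le {ι : Type*} [Fintype ι] [DecidableEq ι] (hn : 0 < n) (N : ℕ)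
    (hN : Fintype.card ι ≤ N) :
    ∑ φ : ι → Fin n, (1 / (n : ℝ)) ^ (Finset.univ.image φ).card ≤ Real.exp 1 * N ^ N := by
  have h1 : ∑ φ : ι → Fin n, (1 / (n : ℝ)) ^ (Finset.univ.image φ).card =
      ∑ S : Finset (Fin n), ∑ φ : ι → Fin n with Finset.univ.image φ = S,
        (1 / (n : ℝ)) ^ S.card := by
    rw [← Finset.sum_fiberwise Finset.univ (fun φ : ι → Fin n => Finset.univ.image φ)]
    refine Finset.sum_congr rfl fun S _ => Finset.sum_congr rfl fun φ hφ => ?_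
    rw [(Finset.mem_filter.1 hφ).2]
  have h2 : ∀ S : Finset (Fin n), (∑ φ : ι → Fin n with Finset.univ.image φ = S,
      (1 / (n : ℝ)) ^ S.card) ≤ (N : ℝ) ^ N * (1 / (n : ℝ)) ^ S.card := by
    intro S
    rw [Finset.sum_const, nsmul_eq_mul]
    refine mul_le_mul_of_nonneg_right ?_ (by positivity)
    rcases (Finset.univ.filter fun φ : ι → Fin n => Finset.univ.image φ = S).eq_empty_or_nonempty
      with he | ⟨φ, hφ⟩
    · rw [he]; simp
    · have hS : S.card ≤ N := by
        rw [← (Finset.mem_filter.1 hφ).2]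
        exact Finset.card_image_le.trans (by simpa using hN)
      have hsub : (Finset.univ.filter fun φ : ι → Fin n => Finset.univ.image φ = S) ⊆
          Fintype.piFinset fun _ => S := by
        intro ψ hψ
        rw [Fintype.mem_piFinset]
        intro i
        rw [← (Finset.mem_filter.1 hψ).2]
        exact Finset.mem_image_of_mem _ (Finset.mem_univ i)
      have := Finset.card_le_card hsub
      rw [Fintype.card_piFinset, Finset.prod_const, Finset.card_univ] at this
      have hN0 : N ^ Fintype.card ι ≤ N ^ N := by
        rcases Nat.eq_zero_or_pos N with rfl | h
        · have : Fintype.card ι = 0 := by omega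
          rw [this]
        · exact Nat.pow_le_pow_right h hN
      exact_mod_cast this.trans ((Nat.pow_le_pow_left hS _).trans hN0)
  rw [h1]
  refine (Finset.sum_le_sum fun S _ => h2 S).trans ?_
  rw [← Finset.mul_sum, mul_comm]
  refine mul_le_mul_of_nonneg_right ?_ (by positivity)
  have h3 : ∑ S : Finset (Fin n), (1 / (n : ℝ)) ^ S.card = (1 / (n : ℝ) + 1) ^ n := by
    have := Finset.sum_pow_mul_eq_add_pow (1 / (n : ℝ)) 1 (Finset.univ : Finset (Fin n))
    simpa using this
  rw [h3]
  calc (1 / (n : ℝ) + 1) ^ n ≤ Real.exp (1 / n) ^ n :=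
        pow_le_pow_left₀ (by positivity) (Real.add_one_le_exp _) _
    _ = Real.exp 1 := by
      rw [← Real.exp_nat_mul]
      congr 1
      field_simp

lemma sum_sum_pow_card_image_le {ι : Type*} [Fintype ι] [DecidableEq ι] (hn : 0 < n) {N : ℕ}
    (hN : 2 * Fintype.card ι ≤ N) (J : Finset (ι → Fin n)) :
    ∑ φ ∈ J, ∑ ψ ∈ J,
      (1 / (n : ℝ)) ^ (Finset.univ.image φ ∪ Finset.univ.image ψ).card ≤ Real.exp 1 * N ^ N := by
  have h := sum_pow_card_image_le (ι := ι ⊕ ι) hn N (by rw [Fintype.card_sum]; omega)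
  rw [← (Equiv.sumArrowEquivProdArrow ι ι (Fin n)).symm.sum_comp, Fintype.sum_prod_type] at h
  refine le_trans ?_ h
  have himg : ∀ φ ψ : ι → Fin n,
      Finset.univ.image ((Equiv.sumArrowEquivProdArrow ι ι (Fin n)).symm (φ, ψ)) =
        Finset.univ.image φ ∪ Finset.univ.image ψ := by
    intro φ ψ
    ext v
    simp [Equiv.sumArrowEquivProdArrow]
  simp_rw [himg]
  calc _ ≤ ∑ φ ∈ J, ∑ ψ : ι → Fin n,
        (1 / (n : ℝ)) ^ (Finset.univ.image φ ∪ Finset.univ.image ψ).card :=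
        Finset.sum_le_sum fun φ _ => Finset.sum_le_sum_of_subset_of_nonneg (Finset.subset_univ _)
          fun _ _ _ => by positivity
    _ ≤ _ := Finset.sum_le_sum_of_subset_of_nonneg (Finset.subset_univ _)
          fun _ _ _ => Finset.sum_nonneg fun _ _ => by positivity

/-- A tuple as a path, constant after time `r`. -/
def walk {r : ℕ} (α : Fin (r + 1) → Fin n) : ℕ → Fin n := fun k => α ⟨min k r, by omega⟩

@[simp] lemma walk_zero {r : ℕ} (α : Fin (r + 1) → Fin n) : walk α 0 = α 0 := by
  simp [walk]

@[simp] lemma walk_last {r : ℕ} (α : Fin (r + 1) → Fin n) : walk α r = α (Fin.last r) := by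
  simp [walk, Fin.last]

lemma walk_val {r : ℕ} (α : Fin (r + 1) → Fin n) (i : Fin (r + 1)) : walk α i = α i := by
  have := i.2
  unfold walk
  congr 1
  ext
  simp only
  omega

lemma injOn_walk {r : ℕ} {α : Fin (r + 1) → Fin n} (hα : Function.Injective α) :
    Set.InjOn (walk α) (Set.Iic r) := by
  intro k hk l hl h
  have := Fin.mk.inj_iff.1 (hα h)
  simp only [Set.mem_Iic] at hk hl
  omega

lemma pathVerts_walk {r : ℕ} (α : Fin (r + 1) → Fin n) :
    pathVerts (walk α) r = Finset.univ.image α := by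
  ext v
  constructor
  · intro hv
    obtain ⟨k, _, rfl⟩ := exists_of_mem_pathVerts hv
    exact Finset.mem_image_of_mem _ (Finset.mem_univ _)
  · intro hv
    obtain ⟨i, _, rfl⟩ := Finset.mem_image.1 hv
    rw [← walk_val α i]
    exact mem_pathVerts (by omega)

/-- The self-avoiding walks of length `r` that end among the first `m` vertices. -/
noncomputable def walks (n r m : ℕ) : Finset (Fin (r + 1) → Fin n) :=
  Finset.univ.filter fun α => Function.Injective α ∧ (α (Fin.last r)).val < m

lemma mem_walks {r m : ℕ} {α : Fin (r + 1) → Fin n} :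
    α ∈ walks n r m ↔ Function.Injective α ∧ (α (Fin.last r)).val < m := by
  simp [walks]

lemma card_filter_val_lt {m : ℕ} (hm : m ≤ n) :
    (Finset.univ.filter fun i : Fin n => i.val < m).card = m := by
  rw [Fin.card_filter_val_lt]
  exact min_eq_right hm

lemma card_last_lt (n r : ℕ) {m : ℕ} (hm : m ≤ n) :
    (Finset.univ.filter fun α : Fin (r + 1) → Fin n => (α (Fin.last r)).val < m).card
      = n ^ r * m := by
  have : (Finset.univ.filter fun α : Fin (r + 1) → Fin n => (α (Fin.last r)).val < m) =
      Fintype.piFinset fun i => if i = Fin.last r then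
        (Finset.univ.filter fun i : Fin n => i.val < m) else Finset.univ := by
    ext α
    simp only [Finset.mem_filter, Finset.mem_univ, true_and, Fintype.mem_piFinset]
    constructor
    · intro h i
      split_ifs with hi
      · subst hi; simpa using h
      · exact Finset.mem_univ _
    · intro h
      simpa using h (Fin.last r)
  rw [this, Fintype.card_piFinset, Fin.prod_univ_castSucc]
  simp [card_filter_val_lt hm, Fin.castSucc_ne_last]

lemma card_walks_le (n r : ℕ) {m : ℕ} (hm : m ≤ n) : ((walks n r m).card : ℝ) ≤ n ^ r * m := by
  rw [← Nat.cast_pow, ← Nat.cast_mul, ← card_last_lt n r hm]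
  exact_mod_cast Finset.card_le_card fun α hα => by
    simpa using (mem_walks.1 hα).2

lemma le_card_walks (hn : 0 < n) (r : ℕ) {m : ℕ} (hm : m ≤ n) :
    (n : ℝ) ^ r * (m - Real.exp 1 * ((r + 1 : ℕ) : ℝ) ^ (r + 1)) ≤ (walks n r m).card := by
  have h1 := sum_pow_card_image_le (ι := Fin (r + 1)) hn (r + 1) (by simp)
  set B := Finset.univ.filter fun α : Fin (r + 1) → Fin n => ¬Function.Injective α with hB
  have hn0 : (0 : ℝ) < n := by exact_mod_cast hn
  have hn1 : 1 / (n : ℝ) ≤ 1 := by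
    rw [div_le_one hn0]; exact_mod_cast hn
  have h2 : (B.card : ℝ) * (1 / (n : ℝ)) ^ r ≤ Real.exp 1 * ((r + 1 : ℕ) : ℝ) ^ (r + 1) := by
    refine le_trans ?_ h1
    rw [← nsmul_eq_mul, ← Finset.sum_const]
    refine (Finset.sum_le_sum fun α hα => ?_).trans
      (Finset.sum_le_sum_of_subset_of_nonneg (Finset.subset_univ B) fun _ _ _ => by positivity)
    refine pow_le_pow_of_le_one (by positivity) hn1 ?_
    have hlt : (Finset.univ.image α).card ≠ (Finset.univ : Finset (Fin (r + 1))).card := by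
      intro h
      refine (Finset.mem_filter.1 hα).2 fun i j hij => ?_
      exact Finset.card_image_iff.1 h (Finset.mem_coe.2 (Finset.mem_univ i))
        (Finset.mem_coe.2 (Finset.mem_univ j)) hij
    have hle : (Finset.univ.image α).card ≤ (Finset.univ : Finset (Fin (r + 1))).card :=
      Finset.card_image_le
    rw [Finset.card_univ, Fintype.card_fin] at hlt hle
    omega
  have h3 : (n : ℝ) ^ r * m ≤ (walks n r m).card + B.card := by
    rw [← Nat.cast_pow, ← Nat.cast_mul, ← card_last_lt n r hm, ← Nat.cast_add, Nat.cast_le]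
    refine le_trans (Finset.card_le_card fun α hα => ?_) (Finset.card_union_le _ _)
    by_cases hi : Function.Injective α
    · exact Finset.mem_union_left _ (mem_walks.2 ⟨hi, (Finset.mem_filter.1 hα).2⟩)
    · exact Finset.mem_union_right _ (Finset.mem_filter.2 ⟨Finset.mem_univ _, hi⟩)
  have h4 : (B.card : ℝ) ≤ n ^ r * (Real.exp 1 * ((r + 1 : ℕ) : ℝ) ^ (r + 1)) := by
    rw [one_div, inv_pow, ← div_eq_mul_inv, div_le_iff₀ (by positivity)] at h2
    linarith
  linarith

/-- The walks that branch from a given one at time `t < r`. -/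
lemma card_branches_le {r m t : ℕ} (hm : m ≤ n) (ht : t < r) (α : Fin (r + 1) → Fin n) :
    (((walks n r m).filter fun β => Branches (walk α) (walk β) r t).card : ℝ) ≤
      n ^ (r - t - 1) * m := by
  have hsub : ((walks n r m).filter fun β => Branches (walk α) (walk β) r t) ⊆
      Fintype.piFinset fun i => if i = Fin.last r then
        (Finset.univ.filter fun i : Fin n => i.val < m) else
        if i.val ≤ t then {α i} else Finset.univ := by
    intro β hβ
    obtain ⟨h1, h2⟩ := Finset.mem_filter.1 hβ
    rw [Fintype.mem_piFinset]
    intro i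
    split_ifs with hi hit
    · subst hi; simpa using (mem_walks.1 h1).2
    · have := h2.1 i hit
      rw [walk_val, walk_val] at this
      simpa using this
    · exact Finset.mem_univ _
  have hcard := Finset.card_le_card hsub
  rw [Fintype.card_piFinset, Fin.prod_univ_castSucc] at hcard
  simp only [Fin.castSucc_ne_last, if_false, if_true,
    card_filter_val_lt hm, Fin.val_castSucc] at hcard
  have hprod : ∏ i : Fin r, ((if i.val ≤ t then {α i.castSucc} else Finset.univ :
      Finset (Fin n))).card = n ^ (r - t - 1) := by
    have : ∀ i : Fin r, ((if i.val ≤ t then {α i.castSucc} else Finset.univ :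
      Finset (Fin n))).card = if i.val ≤ t then 1 else n := by
      intro i; split_ifs <;> simp
    simp_rw [this]
    rw [Fin.prod_univ_eq_prod_range (fun i => if i ≤ t then 1 else n) r]
    rw [← Finset.prod_range_mul_prod_Ico _ (show t + 1 ≤ r by omega)]
    rw [Finset.prod_eq_one (fun i hi => if_pos (by have := Finset.mem_range.1 hi; omega)), one_mul]
    rw [Finset.prod_congr rfl (fun i hi => if_neg (by have := Finset.mem_Ico.1 hi; omega))]
    rw [Finset.prod_const, Nat.card_Ico]
    congr 1
  rw [hprod] at hcard
  exact_mod_cast hcard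

lemma card_branches_last_le {r m : ℕ} (α : Fin (r + 1) → Fin n) :
    (((walks n r m).filter fun β => Branches (walk α) (walk β) r r).card : ℝ) ≤ 1 := by
  have : ((walks n r m).filter fun β => Branches (walk α) (walk β) r r).card ≤ 1 := by
    rw [Finset.card_le_one]
    intro β hβ γ hγ
    funext i
    have h1 := (Finset.mem_filter.1 hβ).2.1 i (by omega)
    have h2 := (Finset.mem_filter.1 hγ).2.1 i (by omega)
    rw [← walk_val β, ← walk_val γ, h1, h2]
  exact_mod_cast this

/-- The value of a label as an integer sign. -/
def sgInt (i : Fin 2) : ℤ := if i = 0 then 1 else -1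

lemma sgInt_cast (i : Fin 2) : (sgInt i : ℝ) = sg i := by
  unfold sgInt sg
  split_ifs <;> simp

/-- The signed number of walks in `g` from `u`, each counted with the label of its end. -/
noncomputable def reach (r m : ℕ) (g : VPair n → Bool) (x : Fin n → Fin 2) (u : Fin n) : ℤ :=
  ∑ α ∈ walks n r m, if α 0 = u ∧ Kept g (pathEdges (walk α) r) then sgInt (x (α (Fin.last r)))
    else 0

lemma reach_congr (r m : ℕ) (g : VPair n → Bool) {x y : Fin n → Fin 2}
    (h : ∀ u : Fin n, u.val < m → x u = y u) (u : Fin n) : reach r m g x u = reach r m g y u :=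
  Finset.sum_congr rfl fun α hα => by rw [h _ (mem_walks.1 hα).2]

/-- The signed agreement of the walk counts with the labels. -/
noncomputable def signal (r m : ℕ) (g : VPair n → Bool) (x : Fin n → Fin 2) : ℝ :=
  ∑ u, sg (x u) * reach r m g x u

/-- The total energy of the walk counts. -/
noncomputable def energy (r m : ℕ) (g : VPair n → Bool) (x : Fin n → Fin 2) : ℝ :=
  ∑ u, (reach r m g x u : ℝ) ^ 2

lemma signal_eq (r m : ℕ) (g : VPair n → Bool) (x : Fin n → Fin 2) :
    signal r m g x = ∑ α ∈ walks n r m, (sg (x (α 0)) * sg (x (α (Fin.last r)))) *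
      (if Kept g (pathEdges (walk α) r) then 1 else 0) := by
  unfold signal reach
  simp_rw [Int.cast_sum, Finset.mul_sum]
  rw [Finset.sum_comm]
  refine Finset.sum_congr rfl fun α _ => ?_
  rw [Finset.sum_eq_single (α 0)]
  · by_cases h : Kept g (pathEdges (walk α) r) <;> simp [h, sgInt_cast]
  · intro u _ hu
    simp [hu.symm]
  · simp

lemma energy_eq (r m : ℕ) (g : VPair n → Bool) (x : Fin n → Fin 2) :
    energy r m g x = ∑ α ∈ walks n r m, ∑ β ∈ walks n r m, if α 0 = β 0 then
      (sg (x (α (Fin.last r))) * sg (x (β (Fin.last r)))) *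
        (if Kept g (pathEdges (walk α) r ∪ pathEdges (walk β) r) then 1 else 0) else 0 := by
  unfold energy reach
  simp_rw [sq, Int.cast_sum, Finset.sum_mul_sum]
  rw [Finset.sum_comm]
  refine Finset.sum_congr rfl fun α _ => ?_
  rw [Finset.sum_comm]
  refine Finset.sum_congr rfl fun β _ => ?_
  rw [Finset.sum_eq_single (α 0)]
  · simp only [kept_union, true_and]
    by_cases h : Kept g (pathEdges (walk α) r) <;>
    by_cases h' : Kept g (pathEdges (walk β) r) <;>
    by_cases h0 : α 0 = β 0 <;> simp [h, h', h0, sgInt_cast, eq_comm]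
  · intro u _ hu
    simp [hu.symm]
  · simp

/-- A constant for the variances of configurations on `N` vertices. -/
noncomputable def varConst (D : ℝ) (N : ℕ) : ℝ :=
  2 * D ^ (2 * N) * (Real.exp 1 * ((2 * N : ℕ) : ℝ) ^ (2 * N))

lemma dependsOn_sg (u v : Fin n) {S : Set (Fin n)} (hu : u ∈ S) (hv : v ∈ S) :
    DependsOn (fun x : Fin n → Fin 2 => sg (x u) * sg (x v)) S := by
  intro x y h
  simp only [h u hu, h v hv]

lemma abs_sg_mul (i j : Fin 2) : |sg i * sg j| ≤ 1 := by
  rw [abs_mul, abs_sg, abs_sg, one_mul]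

section moments

variable {a b q D : ℝ} {r m : ℕ}

lemma variance_signal_le (hs : |(1 - q) * ((a - b) / 2)| ≤ (1 - q) * ((a + b) / 2))
    (hD : (1 - q) * ((a + b) / 2) + |(1 - q) * ((a - b) / 2)| ≤ D) (hD1 : 1 ≤ D) (hDn : D ≤ n) :
    expect a b q (fun (x : Fin n → Fin 2) h => (signal r m (layer h) x -
      expect a b q (fun (x : Fin n → Fin 2) h => signal r m (layer h) x)) ^ 2) ≤
        varConst D (r + 1) * n := by
  have hn : 0 < n := by
    have : (0 : ℝ) < n := by linarith
    exact_mod_cast this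
  refine (variance_le (walks n r m) (fun α => Finset.univ.image α)
    (fun α => pathEdges (walk α) r) (fun α x => sg (x (α 0)) * sg (x (α (Fin.last r))))
    (M := r + 1) hs hD hD1 hDn ?_ ?_ ?_ ?_ ?_ ?_ (fun x h => signal_eq r m (layer h) x)).trans ?_
  · exact fun α hα p hp => not_isDiag_of_mem_pathEdges (injOn_walk (mem_walks.1 hα).1) hp
  · intro α _ p hp v hv
    rw [← pathVerts_walk]
    exact mem_pathVerts_of_mem hp hv
  · intro α _ u hu v hv
    rw [← pathVerts_walk] at hu hv
    exact reachable_of_mem_pathVerts hu hv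
  · intro α _
    exact dependsOn_sg _ _ (by simp) (by simp)
  · exact fun α _ x => abs_sg_mul _ _
  · exact fun α _ => Finset.card_image_le.trans (by simp)
  · have := sum_sum_pow_card_image_le (ι := Fin (r + 1)) hn (N := 2 * (r + 1)) (by simp)
      (walks n r m)
    calc _ ≤ 2 * n * D ^ (2 * (r + 1)) *
          (Real.exp 1 * ((2 * (r + 1) : ℕ) : ℝ) ^ (2 * (r + 1))) := by
          gcongr
      _ = _ := by unfold varConst; ring

/-- Pairs of walks from the same vertex. -/
noncomputable def walkPairs (n r m : ℕ) : Finset (Fin (r + 1) ⊕ Fin (r + 1) → Fin n) :=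
  Finset.univ.filter fun γ => γ ∘ Sum.inl ∈ walks n r m ∧ γ ∘ Sum.inr ∈ walks n r m ∧
    γ (Sum.inl 0) = γ (Sum.inr 0)

lemma sum_walkPairs (f : (Fin (r + 1) → Fin n) → (Fin (r + 1) → Fin n) → ℝ) :
    ∑ γ ∈ walkPairs n r m, f (γ ∘ Sum.inl) (γ ∘ Sum.inr) =
      ∑ α ∈ walks n r m, ∑ β ∈ walks n r m, if α 0 = β 0 then f α β else 0 := by
  unfold walkPairs
  rw [Finset.sum_filter, ← (Equiv.sumArrowEquivProdArrow _ _ (Fin n)).symm.sum_comp,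
    Fintype.sum_prod_type, ← Finset.sum_filter_add_sum_filter_not Finset.univ (· ∈ walks n r m)]
  rw [Finset.sum_eq_zero (s := Finset.univ.filter fun α => α ∉ walks n r m), add_zero]
  · rw [Finset.filter_mem_eq_inter, Finset.univ_inter]
    refine Finset.sum_congr rfl fun α hα => ?_
    rw [← Finset.sum_filter_add_sum_filter_not Finset.univ (· ∈ walks n r m),
      Finset.sum_eq_zero (s := Finset.univ.filter fun α => α ∉ walks n r m), add_zero,
      Finset.filter_mem_eq_inter, Finset.univ_inter]
    · refine Finset.sum_congr rfl fun β hβ => ?_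
      have h1 : (Equiv.sumArrowEquivProdArrow _ _ (Fin n)).symm (α, β) ∘ Sum.inl = α := rfl
      have h2 : (Equiv.sumArrowEquivProdArrow _ _ (Fin n)).symm (α, β) ∘ Sum.inr = β := rfl
      rw [h1, h2]
      simp only [hα, hβ, true_and]
      rfl
    · intro β hβ
      refine if_neg fun h => (Finset.mem_filter.1 hβ).2 h.2.1
  · intro α hα
    exact Finset.sum_eq_zero fun β _ => if_neg fun h => (Finset.mem_filter.1 hα).2 h.1

lemma univ_image_sum (γ : Fin (r + 1) ⊕ Fin (r + 1) → Fin n) :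
    Finset.univ.image γ = pathVerts (walk (γ ∘ Sum.inl)) r ∪ pathVerts (walk (γ ∘ Sum.inr)) r := by
  rw [pathVerts_walk, pathVerts_walk]
  ext v
  simp

lemma variance_energy_le (hs : |(1 - q) * ((a - b) / 2)| ≤ (1 - q) * ((a + b) / 2))
    (hD : (1 - q) * ((a + b) / 2) + |(1 - q) * ((a - b) / 2)| ≤ D) (hD1 : 1 ≤ D) (hDn : D ≤ n) :
    expect a b q (fun (x : Fin n → Fin 2) h => (energy r m (layer h) x -
      expect a b q (fun (x : Fin n → Fin 2) h => energy r m (layer h) x)) ^ 2) ≤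
      varConst D (2 * (r + 1)) * n := by
  have hn : 0 < n := by
    have : (0 : ℝ) < n := by linarith
    exact_mod_cast this
  refine (variance_le (walkPairs n r m) (fun γ => Finset.univ.image γ)
    (fun γ => pathEdges (walk (γ ∘ Sum.inl)) r ∪ pathEdges (walk (γ ∘ Sum.inr)) r)
    (fun γ x => sg (x (γ (Sum.inl (Fin.last r)))) * sg (x (γ (Sum.inr (Fin.last r)))))
    (M := 2 * (r + 1)) hs hD hD1 hDn ?_ ?_ ?_ ?_ ?_ ?_ ?_).trans ?_
  · intro γ hγ p hp
    obtain ⟨h1, h2, _⟩ := (Finset.mem_filter.1 hγ).2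
    rcases Finset.mem_union.1 hp with hp | hp
    · exact not_isDiag_of_mem_pathEdges (injOn_walk (mem_walks.1 h1).1) hp
    · exact not_isDiag_of_mem_pathEdges (injOn_walk (mem_walks.1 h2).1) hp
  · intro γ _ p hp v hv
    rw [univ_image_sum]
    rcases Finset.mem_union.1 hp with hp | hp
    · exact Finset.mem_union_left _ (mem_pathVerts_of_mem hp hv)
    · exact Finset.mem_union_right _ (mem_pathVerts_of_mem hp hv)
  · intro γ hγ
    obtain ⟨_, _, h0⟩ := (Finset.mem_filter.1 hγ).2
    set α := γ ∘ Sum.inl with hα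
    set β := γ ∘ Sum.inr with hβ
    have h0' : walk α 0 = walk β 0 := by
      rw [walk_zero, walk_zero]; exact h0
    have key : ∀ u ∈ Finset.univ.image γ, (SimpleGraph.fromEdgeSet
        ((pathEdges (walk α) r ∪ pathEdges (walk β) r : Finset (Sym2 (Fin n))) :
          Set (Sym2 (Fin n)))).Reachable u (walk α 0) := by
      intro u hu
      rw [univ_image_sum, ← hα, ← hβ] at hu
      rcases Finset.mem_union.1 hu with h | h
      · exact (reachable_of_mem_pathVerts h (mem_pathVerts (Nat.zero_le r))).mono
          (SimpleGraph.fromEdgeSet_mono (by simp))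
      · rw [h0']
        exact (reachable_of_mem_pathVerts h (mem_pathVerts (Nat.zero_le r))).mono
          (SimpleGraph.fromEdgeSet_mono (by simp))
    exact fun u hu v hv => (key u hu).trans (key v hv).symm
  · intro γ _
    exact dependsOn_sg _ _ (by simp) (by simp)
  · exact fun γ _ x => abs_sg_mul _ _
  · intro γ _
    refine Finset.card_image_le.trans ?_
    simp only [Finset.card_univ, Fintype.card_sum, Fintype.card_fin]
    omega
  · intro x h
    rw [energy_eq]
    exact (sum_walkPairs (n := n) (r := r) (m := m) fun α β =>
      (sg (x (α (Fin.last r))) * sg (x (β (Fin.last r)))) *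
        (if Kept (layer h) (pathEdges (walk α) r ∪ pathEdges (walk β) r) then 1 else 0)).symm
  · have := sum_sum_pow_card_image_le (ι := Fin (r + 1) ⊕ Fin (r + 1)) hn (N := 2 * (2 * (r + 1)))
      (by simp; omega) (walkPairs n r m)
    calc _ ≤ 2 * n * D ^ (2 * (2 * (r + 1))) *
          (Real.exp 1 * ((2 * (2 * (r + 1)) : ℕ) : ℝ) ^ (2 * (2 * (r + 1)))) := by
          gcongr
      _ = _ := by unfold varConst; ring

lemma expect_signal (a b q : ℝ) (r m : ℕ) :
    expect a b q (fun (x : Fin n → Fin 2) h => signal r m (layer h) x) =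
      (walks n r m).card * ((1 - q) * ((a - b) / 2) / n) ^ r := by
  simp_rw [signal_eq]
  rw [expect_sum, ← nsmul_eq_mul, ← Finset.sum_const]
  refine Finset.sum_congr rfl fun α hα => ?_
  have hinj := injOn_walk (mem_walks.1 hα).1
  have hw := expect_kept a b q (fun x => sg (x (α 0)) * sg (x (α (Fin.last r))))
    (S := pathEdges (walk α) r) fun p hp => not_isDiag_of_mem_pathEdges hinj hp
  rw [hw]
  simp_rw [prod_pathEdges hinj, Finset.range_eq_Ico]
  have := avg_peel_sg ((1 - q) * ((a + b) / 2)) ((1 - q) * ((a - b) / 2)) (α := walk α)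
    (Nat.zero_le r) (hinj.mono Set.Icc_subset_Iic_self) (G := fun x => sg (x (walk α 0))) (by
      intro k hk hkr x y hxy
      refine congrArg sg (hxy _ ?_)
      simp only [Set.mem_compl_iff, Set.mem_singleton_iff]
      intro h
      have := hinj (by simp) (by simpa using hkr) h
      omega)
  rw [walk_last] at this
  simp only [walk_zero, sg_mul_self, avg_const, mul_one, Nat.sub_zero] at this
  exact this

lemma avg_branches (d s : ℝ) {α β : ℕ → Fin n} {t : ℕ} (hα : Set.InjOn α (Set.Iic r))
    (hβ : Set.InjOn β (Set.Iic r)) (ht : t ≤ r) (h : Branches α β r t) :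
    (avg fun x => (sg (x (α r)) * sg (x (β r))) *
      ∏ p ∈ pathEdges α r ∪ pathEdges β r, link d s x p) =
      (s / n) ^ (r - t) * ((s / n) ^ (r - t) * (d / n) ^ t) := by
  simp_rw [prod_union_of_branches hα hβ h]
  have h1 := avg_peel_sg d s (α := β) ht (hβ.mono Set.Icc_subset_Iic_self)
    (G := fun x => sg (x (α r)) * ∏ k ∈ Finset.Ico 0 r, link d s x s(α k, α (k + 1))) (by
      intro k hk hkr x y hxy
      have hne : ∀ l ≤ r, x (α l) = y (α l) := by
        intro l hl
        refine hxy _ ?_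
        simp only [Set.mem_compl_iff, Set.mem_singleton_iff]
        intro hh
        exact h.2 k hk hkr (hh ▸ mem_pathVerts hl)
      have h2 : ∏ k ∈ Finset.Ico 0 r, link d s x s(α k, α (k + 1)) =
          ∏ k ∈ Finset.Ico 0 r, link d s y s(α k, α (k + 1)) := by
        refine Finset.prod_congr rfl fun l hl => ?_
        have := (Finset.mem_Ico.1 hl).2
        rw [link_mk, link_mk, hne l (by omega), hne (l + 1) (by omega)]
      simp only [h2, hne r le_rfl])
  have h2 := avg_peel_sg d s (α := α) ht (hα.mono Set.Icc_subset_Iic_self)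
    (G := fun x => sg (x (α t)) * ∏ k ∈ Finset.Ico 0 t, link d s x s(α k, α (k + 1))) (by
      intro k hk hkr x y hxy
      have hne : ∀ l ≤ t, x (α l) = y (α l) := by
        intro l hl
        refine hxy _ ?_
        simp only [Set.mem_compl_iff, Set.mem_singleton_iff]
        intro hh
        have := hα (Set.mem_Iic.2 (by omega)) (Set.mem_Iic.2 hkr) hh
        omega
      have h2 : ∏ k ∈ Finset.Ico 0 t, link d s x s(α k, α (k + 1)) =
          ∏ k ∈ Finset.Ico 0 t, link d s y s(α k, α (k + 1)) := by
        refine Finset.prod_congr rfl fun l hl => ?_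
        have := (Finset.mem_Ico.1 hl).2
        rw [link_mk, link_mk, hne l (by omega), hne (l + 1) (by omega)]
      simp only [h2, hne t le_rfl])
  have h3 := avg_peel d s (α := α) (Nat.zero_le t)
    (hα.mono (Set.Icc_subset_Iic_self.trans (Set.Iic_subset_Iic.2 ht)))
    (G := fun _ => 1) (fun _ _ _ _ _ _ => rfl)
  rw [avg_const, mul_one, Nat.sub_zero] at h3
  rw [← h3]
  have h2' : (avg fun x => sg (x (α r)) * (∏ k ∈ Finset.Ico 0 r, link d s x s(α k, α (k + 1))) *
      sg (x (β t))) = (s / n) ^ (r - t) *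
        avg fun x => 1 * ∏ k ∈ Finset.Ico 0 t, link d s x s(α k, α (k + 1)) := by
    rw [h.1 t le_rfl]
    convert h2 using 2
    · funext x
      rw [← Finset.prod_Ico_consecutive _ (Nat.zero_le t) ht]
      ring
    · congr 1
      funext x
      linear_combination -(∏ k ∈ Finset.Ico 0 t, link d s x s(α k, α (k + 1))) *
        sg_mul_self (x (α t))
  rw [← h2', ← h1]
  congr 1
  funext x
  ring

lemma expect_energy_le (hs : |(1 - q) * ((a - b) / 2)| ≤ (1 - q) * ((a + b) / 2))
    (hD : (1 - q) * ((a + b) / 2) + |(1 - q) * ((a - b) / 2)| ≤ D) (hD1 : 1 ≤ D) (hDn : D ≤ n)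
    (hm : m ≤ n) {ρ : ℝ} (hs0 : (1 - q) * ((a - b) / 2) ≠ 0)
    (hρ : (1 - q) * ((a + b) / 2) = ρ * ((1 - q) * ((a - b) / 2)) ^ 2) :
    expect a b q (fun (x : Fin n → Fin 2) h => energy r m (layer h) x) ≤
      ((1 - q) * ((a - b) / 2)) ^ (2 * r) *
        ((m : ℝ) ^ 2 / n * ∑ t ∈ Finset.range r, ρ ^ t + m * ρ ^ r) + varConst D (r + 1) := by
  have hn0 : (0 : ℝ) < n := by linarith
  have hn : 0 < n := by exact_mod_cast hn0
  set d := (1 - q) * ((a + b) / 2) with hd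
  set s := (1 - q) * ((a - b) / 2) with hsdef
  have hd0 : 0 ≤ d := (abs_nonneg _).trans hs
  have hρ0 : 0 ≤ ρ := by
    by_contra hneg
    push Not at hneg
    have : 0 < s ^ 2 := by positivity
    nlinarith
  -- the contribution of a pair of walks
  set T : (Fin (r + 1) → Fin n) → (Fin (r + 1) → Fin n) → ℝ := fun α β =>
    avg fun x => (sg (x (α (Fin.last r))) * sg (x (β (Fin.last r)))) *
      ∏ p ∈ pathEdges (walk α) r ∪ pathEdges (walk β) r, link d s x p with hT
  set c : ℕ → ℝ := fun t => d ^ t * s ^ (2 * (r - t)) * (1 / n) ^ (r + (r - t)) with hc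
  have hc0 : ∀ t, 0 ≤ c t := fun t => by
    have : 0 ≤ s ^ (2 * (r - t)) := by rw [pow_mul]; positivity
    positivity
  have hE : expect a b q (fun (x : Fin n → Fin 2) h => energy r m (layer h) x) =
      ∑ α ∈ walks n r m, ∑ β ∈ walks n r m, if α 0 = β 0 then T α β else 0 := by
    simp_rw [energy_eq]
    rw [expect_sum]
    refine Finset.sum_congr rfl fun α hα => ?_
    rw [expect_sum]
    refine Finset.sum_congr rfl fun β hβ => ?_
    split_ifs with h0
    · refine expect_kept a b q (fun x => sg (x (α (Fin.last r))) * sg (x (β (Fin.last r)))) ?_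
      intro p hp
      rcases Finset.mem_union.1 hp with hp | hp
      · exact not_isDiag_of_mem_pathEdges (injOn_walk (mem_walks.1 hα).1) hp
      · exact not_isDiag_of_mem_pathEdges (injOn_walk (mem_walks.1 hβ).1) hp
    · exact expect_const 0
  have hpair : ∀ α ∈ walks n r m, ∀ β ∈ walks n r m, (if α 0 = β 0 then T α β else 0) ≤
      (∑ t ∈ Finset.range (r + 1), if Branches (walk α) (walk β) r t then c t else 0) +
        D ^ (2 * (r + 1)) * (1 / (n : ℝ)) ^ (Finset.univ.image α ∪ Finset.univ.image β).card := by
    intro α hα β hβ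
    have hαi := injOn_walk (mem_walks.1 hα).1
    have hβi := injOn_walk (mem_walks.1 hβ).1
    have hsum : 0 ≤ ∑ t ∈ Finset.range (r + 1), if Branches (walk α) (walk β) r t then c t else 0 :=
      Finset.sum_nonneg fun t _ => by split_ifs <;> simp [hc0]
    have hlast : 0 ≤ D ^ (2 * (r + 1)) *
        (1 / (n : ℝ)) ^ (Finset.univ.image α ∪ Finset.univ.image β).card := by positivity
    split_ifs with h0
    · by_cases hbr : ∃ t ≤ r, Branches (walk α) (walk β) r t
      · obtain ⟨t, ht, hbr⟩ := hbr
        have h1 : T α β = c t := by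
          have := avg_branches d s hαi hβi ht hbr
          simp only [walk_last] at this
          rw [hT, hc]
          simp only
          rw [this, div_pow, div_pow, one_div, inv_pow]
          have h2 : (n : ℝ) ^ (r + (r - t)) = n ^ (r - t) * (n ^ (r - t) * n ^ t) := by
            rw [← pow_add, ← pow_add]
            congr 1
            omega
          rw [h2, two_mul, pow_add]
          field_simp
        have h2 : c t ≤ ∑ t ∈ Finset.range (r + 1),
            if Branches (walk α) (walk β) r t then c t else 0 := by
          refine le_trans ?_ (Finset.single_le_sum (f := fun t =>
            if Branches (walk α) (walk β) r t then c t else 0) (fun t _ => ?_)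
            (Finset.mem_range.2 (show t < r + 1 by omega)))
          · simp only [hbr, if_true, le_refl]
          · split_ifs <;> simp [hc0]
        linarith
      · push Not at hbr
        have h1 := card_le_of_not_branches hαi hβi (by simpa using h0) hbr
        have h2 := abs_avg_mul_prod_link_le hs hD
          (c := fun x => sg (x (α (Fin.last r))) * sg (x (β (Fin.last r))))
          (fun x => abs_sg_mul _ _) (pathEdges (walk α) r ∪ pathEdges (walk β) r)
        rw [← pathVerts_walk, ← pathVerts_walk] at *
        have h3 : (pathVerts (walk α) r ∪ pathVerts (walk β) r).card ≤ 2 * (r + 1) := by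
          have := Finset.card_union_le (pathVerts (walk α) r) (pathVerts (walk β) r)
          have := card_pathVerts_le (walk α) r
          have := card_pathVerts_le (walk β) r
          omega
        have h4 : (D / n) ^ (pathEdges (walk α) r ∪ pathEdges (walk β) r).card ≤
            D ^ (2 * (r + 1)) * (1 / (n : ℝ)) ^
              (pathVerts (walk α) r ∪ pathVerts (walk β) r).card := by
          calc _ ≤ (D / n) ^ (pathVerts (walk α) r ∪ pathVerts (walk β) r).card :=
                pow_le_pow_of_le_one (by positivity) ((div_le_one hn0).2 hDn) h1
            _ = D ^ (pathVerts (walk α) r ∪ pathVerts (walk β) r).card *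
                (1 / (n : ℝ)) ^ (pathVerts (walk α) r ∪ pathVerts (walk β) r).card := by
              rw [← mul_pow]; congr 1; ring
            _ ≤ _ := by gcongr
        have := (abs_le.1 h2).2
        linarith
    · linarith
  have hmain : ∀ α ∈ walks n r m, ∑ β ∈ walks n r m, (∑ t ∈ Finset.range (r + 1),
      if Branches (walk α) (walk β) r t then c t else 0) ≤
      ∑ t ∈ Finset.range r, n ^ (r - t - 1) * m * c t + c r := by
    intro α hα
    rw [Finset.sum_comm, Finset.sum_range_succ]
    refine add_le_add (Finset.sum_le_sum fun t ht => ?_) ?_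
    · rw [← Finset.sum_filter, Finset.sum_const, nsmul_eq_mul]
      exact mul_le_mul_of_nonneg_right (card_branches_le hm (Finset.mem_range.1 ht) α) (hc0 t)
    · rw [← Finset.sum_filter, Finset.sum_const, nsmul_eq_mul]
      exact (mul_le_mul_of_nonneg_right (card_branches_last_le α) (hc0 r)).trans (one_mul _).le
  have hcr : 0 ≤ ∑ t ∈ Finset.range r, (n : ℝ) ^ (r - t - 1) * m * c t + c r :=
    add_nonneg (Finset.sum_nonneg fun t _ => mul_nonneg (by positivity) (hc0 t)) (hc0 r)
  have hfin : (n : ℝ) ^ r * m * (∑ t ∈ Finset.range r, (n : ℝ) ^ (r - t - 1) * m * c t + c r) =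
      s ^ (2 * r) * ((m : ℝ) ^ 2 / n * ∑ t ∈ Finset.range r, ρ ^ t + m * ρ ^ r) := by
    have hds : ∀ t ≤ r, d ^ t * s ^ (2 * (r - t)) = ρ ^ t * s ^ (2 * r) := by
      intro t ht
      rw [hρ, mul_pow, ← pow_mul, mul_assoc, ← pow_add]
      congr 2
      omega
    rw [mul_add, mul_add, Finset.mul_sum, Finset.mul_sum, Finset.mul_sum]
    congr 1
    · refine Finset.sum_congr rfl fun t ht => ?_
      have ht := Finset.mem_range.1 ht
      rw [hc]
      simp only
      rw [hds t ht.le, one_div, inv_pow]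
      have h2 : (n : ℝ) ^ (r + (r - t)) = n ^ r * n ^ (r - t - 1) * n := by
        rw [← pow_add, ← pow_succ]
        congr 1
        omega
      rw [h2]
      field_simp
    · rw [hc]
      simp only
      rw [hds r le_rfl, one_div, inv_pow, Nat.sub_self, add_zero]
      field_simp
  have hbad := sum_sum_pow_card_image_le (ι := Fin (r + 1)) hn (N := 2 * (r + 1)) (by simp)
    (walks n r m)
  calc _ ≤ ∑ α ∈ walks n r m, ∑ β ∈ walks n r m,
        ((∑ t ∈ Finset.range (r + 1), if Branches (walk α) (walk β) r t then c t else 0) +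
        D ^ (2 * (r + 1)) * (1 / (n : ℝ)) ^ (Finset.univ.image α ∪ Finset.univ.image β).card) := by
        rw [hE]
        exact Finset.sum_le_sum fun α hα => Finset.sum_le_sum fun β hβ => hpair α hα β hβ
    _ = (∑ α ∈ walks n r m, ∑ β ∈ walks n r m,
        ∑ t ∈ Finset.range (r + 1), if Branches (walk α) (walk β) r t then c t else 0) +
        D ^ (2 * (r + 1)) * ∑ α ∈ walks n r m, ∑ β ∈ walks n r m,
          (1 / (n : ℝ)) ^ (Finset.univ.image α ∪ Finset.univ.image β).card := by
      simp_rw [Finset.sum_add_distrib, Finset.mul_sum]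
    _ ≤ (n : ℝ) ^ r * m * (∑ t ∈ Finset.range r, (n : ℝ) ^ (r - t - 1) * m * c t + c r) +
        D ^ (2 * (r + 1)) * (Real.exp 1 * ((2 * (r + 1) : ℕ) : ℝ) ^ (2 * (r + 1))) := by
      refine add_le_add ?_ (mul_le_mul_of_nonneg_left hbad (by positivity))
      refine (Finset.sum_le_sum hmain).trans ?_
      rw [Finset.sum_const, nsmul_eq_mul]
      exact mul_le_mul_of_nonneg_right (card_walks_le n r hm) hcr
    _ ≤ _ := by
      rw [hfin]
      refine add_le_add_right ?_ _
      unfold varConst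
      have : 0 ≤ D ^ (2 * (r + 1)) * (Real.exp 1 * ((2 * (r + 1) : ℕ) : ℝ) ^ (2 * (r + 1))) := by
        positivity
      linarith

end moments

lemma bernoulli_mgf_le {f μ : ℝ} (hf : 0 ≤ f) (hf1 : f ≤ 1) (hμ : |μ| ≤ 1) :
    (1 - f) * Real.exp (μ * (0 - f)) + f * Real.exp (μ * (1 - f)) ≤ Real.exp (f * μ ^ 2) := by
  have key : ∀ t : ℝ, |t| ≤ 1 → Real.exp t ≤ 1 + t + t ^ 2 := by
    intro t ht
    have := (abs_le.1 (Real.abs_exp_sub_one_sub_id_le ht)).2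
    linarith
  have h1 : |μ * (0 - f)| ≤ 1 := by
    rw [abs_mul]
    exact mul_le_one₀ hμ (abs_nonneg _) (abs_le.2 ⟨by linarith, by linarith⟩)
  have h2 : |μ * (1 - f)| ≤ 1 := by
    rw [abs_mul]
    exact mul_le_one₀ hμ (abs_nonneg _) (abs_le.2 ⟨by linarith, by linarith⟩)
  calc _ ≤ (1 - f) * (1 + μ * (0 - f) + (μ * (0 - f)) ^ 2) +
        f * (1 + μ * (1 - f) + (μ * (1 - f)) ^ 2) :=
        add_le_add (mul_le_mul_of_nonneg_left (key _ h1) (by linarith))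
          (mul_le_mul_of_nonneg_left (key _ h2) hf)
    _ = f * μ ^ 2 + 1 - f ^ 2 * μ ^ 2 := by ring
    _ ≤ f * μ ^ 2 + 1 := by
      have : 0 ≤ f ^ 2 * μ ^ 2 := by positivity
      linarith
    _ ≤ _ := Real.add_one_le_exp _

/-- A bound on the expectation of a product functional that holds conditionally on a coarser
configuration `π ∘ h` holds on average, even when the functional depends on `π ∘ h`. -/
lemma sum_prod_mul_prod_le {E L B : Type*} [Fintype E] [Fintype L] [Fintype B]
    [DecidableEq E] [DecidableEq B] (π : L → B)
    (W : E → L → ℝ) (hW : ∀ e l, 0 ≤ W e l) (hW1 : ∀ e, ∑ l, W e l = 1)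
    (φ : (E → B) → E → L → ℝ) (hφ : ∀ ℓ e l, 0 ≤ φ ℓ e l) {K : ℝ}
    (h : ∀ ℓ e, ∑ l with π l = ℓ e, W e l * φ ℓ e l ≤ K * ∑ l with π l = ℓ e, W e l) :
    ∑ c : E → L, (∏ e, W e (c e)) * ∏ e, φ (fun e => π (c e)) e (c e) ≤ K ^ Fintype.card E := by
  have hfil : ∀ ℓ : E → B, (Finset.univ.filter fun c : E → L => (fun e => π (c e)) = ℓ) =
      Fintype.piFinset fun e => Finset.univ.filter fun l => π l = ℓ e := by
    intro ℓ
    ext c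
    simp [Fintype.mem_piFinset, funext_iff]
  have hone : ∑ ℓ : E → B, ∏ e, ∑ l with π l = ℓ e, W e l = 1 := by
    simp_rw [Finset.prod_univ_sum, ← hfil]
    rw [Finset.sum_fiberwise, ← Fintype.prod_sum]
    simp [hW1]
  calc _ = ∑ ℓ : E → B, ∏ e, ∑ l with π l = ℓ e, W e l * φ ℓ e l := by
        rw [← Finset.sum_fiberwise Finset.univ (fun (c : E → L) e => π (c e))]
        refine Finset.sum_congr rfl fun ℓ _ => ?_
        rw [Finset.prod_univ_sum, ← hfil]
        refine Finset.sum_congr rfl fun c hc => ?_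
        rw [(Finset.mem_filter.1 hc).2, Finset.prod_mul_distrib]
    _ ≤ ∑ ℓ : E → B, ∏ e, (K * ∑ l with π l = ℓ e, W e l) :=
        Finset.sum_le_sum fun ℓ _ => Finset.prod_le_prod
          (fun e _ => Finset.sum_nonneg fun l _ => mul_nonneg (hW e l) (hφ ℓ e l)) fun e _ => h ℓ e
    _ = _ := by
      simp_rw [Finset.prod_mul_distrib]
      rw [← Finset.mul_sum, hone, mul_one, Finset.prod_const, Finset.card_univ]

/-- The probability that an edge is in the second layer, given that it is not in the first. -/
noncomputable def revealProb (q p : ℝ) : ℝ := q * p / (1 - (1 - q) * p)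

lemma revealProb_mem {q p : ℝ} (hq : 0 ≤ q) (hq1 : q ≤ 1) (hp : 0 ≤ p) (hp1 : p ≤ 1 / 2) :
    revealProb q p ∈ Set.Icc 0 (2 * p) := by
  have h1 : 1 / 2 ≤ 1 - (1 - q) * p := by nlinarith
  constructor
  · exact div_nonneg (mul_nonneg hq hp) (by linarith)
  · rw [revealProb, div_le_iff₀ (by linarith)]
    nlinarith

lemma le_abs_revealProb_sub {q p p' : ℝ} (hq : 0 ≤ q) (hq1 : q ≤ 1) (hp : 0 ≤ p) (hp1 : p ≤ 1 / 2)
    (hp' : 0 ≤ p') (hp1' : p' ≤ 1 / 2) : q * |p - p'| ≤ |revealProb q p - revealProb q p'| := by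
  have h1 : 1 / 2 ≤ 1 - (1 - q) * p := by nlinarith
  have h2 : 1 / 2 ≤ 1 - (1 - q) * p' := by nlinarith
  have h3 : 1 - (1 - q) * p ≤ 1 := by nlinarith
  have h4 : 1 - (1 - q) * p' ≤ 1 := by nlinarith
  have h5 : 0 < (1 - (1 - q) * p) * (1 - (1 - q) * p') := mul_pos (by linarith) (by linarith)
  have heq : revealProb q p - revealProb q p' =
      q * (p - p') / ((1 - (1 - q) * p) * (1 - (1 - q) * p')) := by
    unfold revealProb
    rw [div_sub_div _ _ (by linarith) (by linarith)]
    congr 1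
    ring
  rw [heq, abs_div, abs_mul, abs_of_nonneg hq, abs_of_pos h5]
  refine le_div_self (mul_nonneg hq (abs_nonneg _)) h5 ?_
  nlinarith

lemma revealed_mgf_le {q p μ F : ℝ} (hq : 0 ≤ q) (hq1 : q ≤ 1) (hp : 0 ≤ p) (hp1 : p ≤ 1 / 2)
    (hμ : |μ| ≤ 1) (hF : revealProb q p ≤ F) (t : Bool) :
    ∑ l with fstLayer l = t, pairWeight q p l *
        Real.exp (if t then 0 else μ * ((if sndLayer l then 1 else 0) - revealProb q p)) ≤
      Real.exp (F * μ ^ 2) * ∑ l with fstLayer l = t, pairWeight q p l := by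
  have hf := revealProb_mem hq hq1 hp hp1
  have h1 : 1 / 2 ≤ 1 - (1 - q) * p := by nlinarith
  have hF0 : 1 ≤ Real.exp (F * μ ^ 2) := Real.one_le_exp (mul_nonneg (hf.1.trans hF) (sq_nonneg μ))
  cases t
  · have hb := bernoulli_mgf_le hf.1 (hf.2.trans (by linarith)) hμ
    have hb' : (1 - revealProb q p) * Real.exp (μ * (0 - revealProb q p)) +
        revealProb q p * Real.exp (μ * (1 - revealProb q p)) ≤ Real.exp (F * μ ^ 2) :=
      hb.trans (Real.exp_le_exp.2 (mul_le_mul_of_nonneg_right hF (sq_nonneg μ)))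
    have hr : q * p = (1 - (1 - q) * p) * revealProb q p := by
      rw [revealProb, mul_div_cancel₀]
      linarith
    have hr' : 1 - p = (1 - (1 - q) * p) * (1 - revealProb q p) := by linarith
    have := mul_le_mul_of_nonneg_left hb' (show 0 ≤ 1 - (1 - q) * p by linarith)
    have hset : (Finset.univ.filter fun l => fstLayer l = false) =
        {(true, true), (false, true), (false, false)} := by
      ext ⟨l₁, l₂⟩
      cases l₁ <;> cases l₂ <;> simp [fstLayer]
    rw [hset]
    rw [Finset.sum_insert (by simp), Finset.sum_insert (by simp), Finset.sum_singleton,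
      Finset.sum_insert (by simp), Finset.sum_insert (by simp), Finset.sum_singleton]
    simp only [sndLayer, pairWeight, Bool.and_true, Bool.and_false, if_true, Bool.false_eq_true,
      if_false]
    refine le_trans (le_of_eq ?_) (this.trans (le_of_eq ?_))
    · linear_combination Real.exp (μ * (1 - revealProb q p)) * hr +
        Real.exp (μ * (0 - revealProb q p)) * hr'
    · ring
  · simp only [if_true, Real.exp_zero, mul_one]
    refine le_mul_of_one_le_left (Finset.sum_nonneg fun l _ => ?_) hF0
    exact pairWeight_nonneg hq hq1 hp (by linarith) _

lemma sum_pairs (z : Fin n → ℝ) :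
    ∑ e : VPair n, z e.1.1 * z e.1.2 = ((∑ u, z u) ^ 2 - ∑ u, z u ^ 2) / 2 := by
  have h1 : ∑ e : VPair n, z e.1.1 * z e.1.2 =
      ∑ u, ∑ v, if u < v then z u * z v else 0 := by
    rw [← Fintype.sum_prod_type', ← Finset.sum_filter]
    exact (Finset.sum_subtype (Finset.univ.filter fun p : Fin n × Fin n => p.1 < p.2) (by simp)
      (fun p => z p.1 * z p.2)).symm
  have h2 : (∑ u, z u) ^ 2 = ∑ u, ∑ v, z u * z v := by rw [sq, Finset.sum_mul_sum]
  have h3 : ∑ u, ∑ v, (if u < v then z u * z v else 0) =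
      ∑ u, ∑ v, if v < u then z u * z v else 0 := by
    rw [Finset.sum_comm]
    exact Finset.sum_congr rfl fun u _ => Finset.sum_congr rfl fun v _ => by rw [mul_comm]
  have h4 : ∑ u, z u ^ 2 = ∑ u, ∑ v, if u = v then z u * z v else 0 := by
    simp [sq]
  have h5 : ∑ u, ∑ v, z u * z v = (∑ u, ∑ v, if u < v then z u * z v else 0) +
      (∑ u, ∑ v, if v < u then z u * z v else 0) + ∑ u, ∑ v, if u = v then z u * z v else 0 := by
    simp_rw [← Finset.sum_add_distrib]
    refine Finset.sum_congr rfl fun u _ => Finset.sum_congr rfl fun v _ => ?_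
    rcases lt_trichotomy u v with h | h | h
    · simp [h, h.not_gt, h.ne]
    · simp [h]
    · simp [h, h.not_gt, h.ne']
  rw [h1, h2, h4, h5, ← h3]
  ring

lemma card_vpair_le (n : ℕ) : Fintype.card (VPair n) ≤ n ^ 2 := by
  refine (Fintype.card_subtype_le _).trans ?_
  simp [sq]

/-- The centering constant of the test statistic. -/
noncomputable def revealMean (n : ℕ) (a b q : ℝ) : ℝ :=
  (revealProb q (a / n) + revealProb q (b / n)) / 2

/-- The signal strength of the test statistic. -/
noncomputable def revealGap (n : ℕ) (a b q : ℝ) : ℝ :=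
  (revealProb q (a / n) - revealProb q (b / n)) / 2

lemma revealProb_edgeProb (a b q : ℝ) (x : Fin n → Fin 2) (e : VPair n) :
    revealProb q (edgeProb a b x e) =
      revealMean n a b q + revealGap n a b q * (sg (x e.1.1) * sg (x e.1.2)) := by
  have h := indicator_eq (x e.1.1) (x e.1.2)
  unfold revealMean revealGap
  simp only [edgeProb, ssbmW, Matrix.of_apply]
  by_cases hx : x e.1.1 = x e.1.2
  · rw [if_pos hx] at h ⊢
    have : sg (x e.1.1) * sg (x e.1.2) = 1 := by linarith
    rw [this]; ring
  · rw [if_neg hx] at h ⊢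
    have : sg (x e.1.1) * sg (x e.1.2) = -1 := by linarith
    rw [this]; ring

/-- The test statistic: correlation of a labelling with the edges of the second layer. -/
noncomputable def testStat (c : ℝ) (h : VPair n → Bool × Bool) (y : Fin n → Fin 2) : ℝ :=
  ∑ e : VPair n, if layer h e then 0 else
    ((if sndLayer (h e) then 1 else 0) - c) * (sg (y e.1.1) * sg (y e.1.2))

/-- The conditional mean of the test statistic given the first layer. -/
noncomputable def testMean (d : ℝ) (h : VPair n → Bool × Bool) (x y : Fin n → Fin 2) : ℝ :=
  ∑ e : VPair n, if layer h e then 0 else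
    d * (sg (x e.1.1) * sg (x e.1.2)) * (sg (y e.1.1) * sg (y e.1.2))

lemma testMgf_le {a b q μ F : ℝ} (hq : 0 ≤ q) (hq1 : q ≤ 1) (ha : a / n ∈ Set.Icc (0 : ℝ) (1 / 2))
    (hb : b / n ∈ Set.Icc (0 : ℝ) (1 / 2)) (hμ : |μ| ≤ 1) (hFa : revealProb q (a / n) ≤ F)
    (hFb : revealProb q (b / n) ≤ F) (x : Fin n → Fin 2)
    (y : (VPair n → Bool) → Fin n → Fin 2) :
    ∑ h, weight a b q x h * Real.exp (μ * (testStat (revealMean n a b q) h (y (layer h)) -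
      testMean (revealGap n a b q) h x (y (layer h)))) ≤ Real.exp (F * μ ^ 2 * n ^ 2) := by
  have hp : ∀ e, edgeProb a b x e ∈ Set.Icc (0 : ℝ) (1 / 2) := fun e => edgeProb_mem x e ha hb
  have hpF : ∀ e, revealProb q (edgeProb a b x e) ≤ F := by
    intro e
    simp only [edgeProb, ssbmW, Matrix.of_apply]
    split_ifs <;> assumption
  have hF0 : 0 ≤ F := (revealProb_mem hq hq1 ha.1 ha.2).1.trans hFa
  have key := sum_prod_mul_prod_le fstLayer
    (fun (e : VPair n) l => pairWeight q (edgeProb a b x e) l)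
    (fun e l => pairWeight_nonneg hq hq1 (hp e).1 ((hp e).2.trans (by norm_num)) l)
    (fun e => sum_pairWeight _ _)
    (fun ℓ e l => Real.exp (if ℓ e then 0 else μ * (sg (y ℓ e.1.1) * sg (y ℓ e.1.2)) *
      ((if sndLayer l then 1 else 0) - revealProb q (edgeProb a b x e))))
    (fun _ _ _ => (Real.exp_pos _).le) (K := Real.exp (F * μ ^ 2)) (by
      intro ℓ e
      have hs : |sg (y ℓ e.1.1) * sg (y ℓ e.1.2)| = 1 := by rw [abs_mul, abs_sg, abs_sg, one_mul]
      have h1 := revealed_mgf_le hq hq1 (hp e).1 (hp e).2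
        (μ := μ * (sg (y ℓ e.1.1) * sg (y ℓ e.1.2))) (by rw [abs_mul, hs, mul_one]; exact hμ)
        (hpF e) (ℓ e)
      have h2 : (μ * (sg (y ℓ e.1.1) * sg (y ℓ e.1.2))) ^ 2 = μ ^ 2 := by
        rw [mul_pow, ← sq_abs (sg _ * sg _), hs, one_pow, mul_one]
      rw [h2] at h1
      exact h1)
  refine le_trans (le_of_eq ?_) (key.trans ?_)
  · refine Finset.sum_congr rfl fun h _ => ?_
    unfold weight
    congr 1
    rw [← Real.exp_sum]
    congr 1
    unfold testStat testMean
    rw [← Finset.sum_sub_distrib, Finset.mul_sum]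
    refine Finset.sum_congr rfl fun e _ => ?_
    change μ * _ = if layer h e = true then 0
      else μ * (sg (y (layer h) e.1.1) * sg (y (layer h) e.1.2)) *
      ((if sndLayer (h e) then 1 else 0) - revealProb q (edgeProb a b x e))
    rw [revealProb_edgeProb]
    by_cases hl : layer h e = true
    · simp only [hl, if_true, sub_self, mul_zero]
    · simp only [if_neg hl]
      ring
  · rw [← Real.exp_nat_mul]
    refine Real.exp_le_exp.2 ?_
    rw [mul_comm]
    refine mul_le_mul_of_nonneg_left ?_ (by positivity)
    exact_mod_cast card_vpair_le n

/-- The probability that the test statistic of a candidate labelling deviates from its mean. -/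
lemma prob_testStat_le {a b q F κ : ℝ} (H : Admissible n a b q)
    (ha : a / n ∈ Set.Icc (0 : ℝ) (1 / 2))
    (hb : b / n ∈ Set.Icc (0 : ℝ) (1 / 2)) (hFa : revealProb q (a / n) ≤ F / n)
    (hFb : revealProb q (b / n) ≤ F / n) (hn : 0 < n) (hF : 0 < F) (hκ : 0 ≤ κ) (hκF : κ ≤ 2 * F)
    (y : (VPair n → Bool) → Fin n → Fin 2) :
    expect a b q (fun x h => if κ * n < |testStat (revealMean n a b q) h (y (layer h)) -
      testMean (revealGap n a b q) h x (y (layer h))| then 1 else 0) ≤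
      2 * Real.exp (-(κ ^ 2 / (4 * F)) * n) := by
  set μ := κ / (2 * F) with hμ
  have hμ0 : 0 ≤ μ := by positivity
  have hμ1 : |μ| ≤ 1 := by
    rw [abs_of_nonneg hμ0, hμ, div_le_one (by positivity)]
    exact hκF
  have hμ1' : |-μ| ≤ 1 := by rwa [abs_neg]
  have hn0 : (0 : ℝ) < n := by exact_mod_cast hn
  set Z : (Fin n → Fin 2) → (VPair n → Bool × Bool) → ℝ := fun x h =>
    testStat (revealMean n a b q) h (y (layer h)) - testMean (revealGap n a b q) h x (y (layer h))
    with hZ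
  have hmgf : ∀ ν : ℝ, |ν| ≤ 1 → expect a b q (fun x h => Real.exp (ν * Z x h)) ≤
      Real.exp (F / n * ν ^ 2 * n ^ 2) := by
    intro ν hν
    rw [← avg_const (n := n) (Real.exp (F / n * ν ^ 2 * n ^ 2))]
    exact avg_mono fun x => testMgf_le H.q_nonneg H.q_le_one ha hb hν hFa hFb x y
  have hpt : ∀ x h, (if κ * n < |Z x h| then (1 : ℝ) else 0) ≤
      Real.exp (-(μ * κ * n)) * (Real.exp (μ * Z x h) + Real.exp (-μ * Z x h)) := by
    intro x h
    split_ifs with hlt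
    · rw [mul_add, ← Real.exp_add, ← Real.exp_add]
      have h1 := Real.exp_pos (-(μ * κ * n) + μ * Z x h)
      have h2 := Real.exp_pos (-(μ * κ * n) + -μ * Z x h)
      rcases lt_abs.1 hlt with hlt | hlt
      · have : 1 ≤ Real.exp (-(μ * κ * n) + μ * Z x h) := Real.one_le_exp (by nlinarith)
        linarith
      · have : 1 ≤ Real.exp (-(μ * κ * n) + -μ * Z x h) := Real.one_le_exp (by nlinarith)
        linarith
    · positivity
  refine (expect_mono H hpt).trans ?_
  rw [expect_const_mul, expect_add]
  have h1 := hmgf μ hμ1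
  have h2 := hmgf (-μ) hμ1'
  rw [neg_sq] at h2
  calc _ ≤ Real.exp (-(μ * κ * n)) * (Real.exp (F / n * μ ^ 2 * n ^ 2) +
        Real.exp (F / n * μ ^ 2 * n ^ 2)) :=
        mul_le_mul_of_nonneg_left (add_le_add h1 h2) (Real.exp_pos _).le
    _ = 2 * Real.exp (-(μ * κ * n) + F / n * μ ^ 2 * n ^ 2) := by
      rw [Real.exp_add]; ring
    _ = _ := by
      congr 2
      rw [hμ]
      field_simp
      ring

/-- The number of edges in the first layer. -/
noncomputable def layerCard (h : VPair n → Bool × Bool) : ℝ :=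
  ∑ e : VPair n, if layer h e then 1 else 0

lemma expect_layerCard_le {a b q D : ℝ}
    (hs : |(1 - q) * ((a - b) / 2)| ≤ (1 - q) * ((a + b) / 2))
    (hD : (1 - q) * ((a + b) / 2) + |(1 - q) * ((a - b) / 2)| ≤ D) (hn : 0 < n) :
    expect a b q (fun (_ : Fin n → Fin 2) h => layerCard h) ≤ D * n := by
  have hn0 : (0 : ℝ) < n := by exact_mod_cast hn
  have hD0 : 0 ≤ D := by
    have := abs_nonneg ((1 - q) * ((a - b) / 2))
    linarith
  unfold layerCard
  rw [expect_sum]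
  have : ∀ e : VPair n, expect a b q (fun (_ : Fin n → Fin 2) h => if layer h e then 1 else 0)
      ≤ D / n := by
    intro e
    have hdiag : ∀ p ∈ ({s(e.1.1, e.1.2)} : Finset (Sym2 (Fin n))), ¬p.IsDiag := by
      intro p hp
      rw [Finset.mem_singleton.1 hp, Sym2.mk_isDiag_iff]
      exact e.2.ne
    have h1 := expect_kept a b q (fun _ => 1) hdiag
    have h2 := (abs_le.1 (abs_avg_mul_prod_link_le hs hD (c := fun _ => 1) (by simp)
      {s(e.1.1, e.1.2)})).2
    rw [← h1, Finset.card_singleton, pow_one] at h2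
    have hiff (h : VPair n → Bool × Bool) : layer h e = true ↔
        Kept (layer h) {s(e.1.1, e.1.2)} := by
      constructor
      · rintro he ⟨⟨u, v⟩, huv⟩ h'
        obtain ⟨⟨u', v'⟩, huv'⟩ := e
        simp only [Finset.mem_singleton, Sym2.eq_iff] at h'
        simp only at huv huv'
        rcases h' with ⟨rfl, rfl⟩ | ⟨rfl, rfl⟩
        · exact he
        · exact absurd huv (not_lt.2 huv'.le)
      · intro hk
        exact hk e (Finset.mem_singleton_self _)
    refine le_trans (le_of_eq ?_) h2
    congr 1
    funext x h
    simp only [hiff, one_mul]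
  refine (Finset.sum_le_sum fun e _ => this e).trans ?_
  rw [Finset.sum_const, nsmul_eq_mul, Finset.card_univ]
  calc (Fintype.card (VPair n) : ℝ) * (D / n) ≤ (n : ℝ) ^ 2 * (D / n) :=
        mul_le_mul_of_nonneg_right (by exact_mod_cast card_vpair_le n) (by positivity)
    _ = D * n := by field_simp

/-- The mean of the test statistic is governed by the overlap. -/
lemma abs_testMean_sub_le (d : ℝ) (h : VPair n → Bool × Bool) (x y : Fin n → Fin 2) :
    |testMean d h x y - d / 2 * overlap x y ^ 2| ≤ |d| * layerCard h + |d| * n / 2 := by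
  have h1 : ∑ e : VPair n, d * (sg (x e.1.1) * sg (x e.1.2)) * (sg (y e.1.1) * sg (y e.1.2)) =
      d / 2 * overlap x y ^ 2 - d * n / 2 := by
    have := sum_pairs fun u => sg (x u) * sg (y u)
    have hsq : ∀ u, (sg (x u) * sg (y u)) ^ 2 = 1 := fun u => by
      rw [mul_pow, sq, sq, sg_mul_self, sg_mul_self, one_mul]
    simp_rw [hsq] at this
    rw [Finset.sum_const, Finset.card_univ, Fintype.card_fin, nsmul_eq_mul, mul_one] at this
    unfold overlap
    rw [Finset.sum_congr rfl fun e _ => show d * (sg (x e.1.1) * sg (x e.1.2)) *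
      (sg (y e.1.1) * sg (y e.1.2)) = d * (sg (x e.1.1) * sg (y e.1.1) *
      (sg (x e.1.2) * sg (y e.1.2))) by ring, ← Finset.mul_sum, this]
    ring
  have h2 : |testMean d h x y -
      ∑ e : VPair n, d * (sg (x e.1.1) * sg (x e.1.2)) * (sg (y e.1.1) * sg (y e.1.2))| ≤
      |d| * layerCard h := by
    unfold testMean layerCard
    rw [← Finset.sum_sub_distrib, Finset.mul_sum]
    refine (Finset.abs_sum_le_sum_abs _ _).trans (Finset.sum_le_sum fun e _ => ?_)
    split_ifs
    · simp [abs_mul, abs_sg]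
    · simp
  rw [h1] at h2
  have h3 : |d * n / 2| = |d| * n / 2 := by
    rw [abs_div, abs_mul, Nat.abs_cast, abs_two]
  rw [abs_le] at h2 ⊢
  have := abs_le.1 h3.le
  constructor <;> linarith [h2.1, h2.2]

/-- Extension by `0` of a labelling of the first `m` vertices. -/
def extendLabels (n : ℕ) {m : ℕ} (σ : Fin m → Fin 2) (u : Fin n) : Fin 2 :=
  if h : u.val < m then σ ⟨u.val, h⟩ else 0

/-- The labelling obtained by thresholding the walk counts at `j - L`, given guessed labels `σ`
of the first `m` vertices. -/
noncomputable def candidate (r L : ℕ) {m : ℕ} (g : VPair n → Bool)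
    (k : (Fin m → Fin 2) × Fin (2 * L)) (u : Fin n) : Fin 2 :=
  if (k.2.val : ℤ) - L < reach r m g (extendLabels n k.1) u then 0 else 1

lemma sum_sg_threshold (L : ℕ) (z : ℤ) :
    ∑ j : Fin (2 * L), sg (if (j.val : ℤ) - L < z then 0 else 1) =
      2 * ((max (-(L : ℤ)) (min (L : ℤ) z) : ℤ) : ℝ) := by
  obtain ⟨k, hk⟩ : ∃ k : ℕ, (k : ℤ) = max (-(L : ℤ)) (min (L : ℤ) z) + L :=
    ⟨(max (-(L : ℤ)) (min (L : ℤ) z) + L).toNat, by omega⟩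
  have hkL : k ≤ 2 * L := by omega
  have h1 : ∀ j : Fin (2 * L), sg (if (j.val : ℤ) - L < z then 0 else 1) =
      2 * (if j.val < k then 1 else 0) - 1 := by
    intro j
    have hj := j.isLt
    by_cases hjk : j.val < k
    · rw [if_pos (by omega), if_pos hjk]; simp [sg]; norm_num
    · rw [if_neg (by omega), if_neg hjk]; simp [sg]
  simp_rw [h1]
  rw [Finset.sum_sub_distrib, ← Finset.mul_sum, Finset.sum_boole, card_filter_val_lt hkL]
  have : ((max (-(L : ℤ)) (min (L : ℤ) z) : ℤ) : ℝ) = k - L := by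
    have h2 : (max (-(L : ℤ)) (min (L : ℤ) z) : ℤ) = k - L := by omega
    rw [h2]; push_cast; ring
  rw [this]
  simp
  ring

lemma abs_clip_sub_le {L : ℕ} (hL : 0 < L) (z : ℤ) :
    |((max (-(L : ℤ)) (min (L : ℤ) z) : ℤ) : ℝ) - z| ≤ (z : ℝ) ^ 2 / L := by
  have hL0 : (0 : ℝ) < L := by exact_mod_cast hL
  rw [le_div_iff₀ hL0]
  have key : |(max (-(L : ℤ)) (min (L : ℤ) z) : ℤ) - z| * L ≤ z ^ 2 := by
    rcases le_total z (-L) with h | h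
    · rw [show max (-(L : ℤ)) (min (L : ℤ) z) = -L by omega, abs_of_nonneg (by omega)]
      nlinarith
    · rcases le_total z L with h' | h'
      · rw [show (max (-(L : ℤ)) (min (L : ℤ) z) : ℤ) = z by omega]
        simp [sq_nonneg]
      · rw [show (max (-(L : ℤ)) (min (L : ℤ) z) : ℤ) = L by omega, abs_of_nonpos (by omega)]
        nlinarith
  exact_mod_cast key

/-- When the walk counts carry a signal, one of the candidates overlaps with the labels. -/
lemma exists_candidate {r m L : ℕ} (hm : m ≤ n) (hL : 0 < L) (g : VPair n → Bool)
    (x : Fin n → Fin 2) {A B : ℝ} (hA : A ≤ signal r m g x) (hB : energy r m g x ≤ B)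
    (hAB : 2 * B ≤ A * L) : ∃ k, A / (2 * L) ≤ overlap x (candidate r L (m := m) g k) := by
  have hL0 : (0 : ℝ) < L := by exact_mod_cast hL
  set σ : Fin m → Fin 2 := fun i => x ⟨i.val, i.isLt.trans_le hm⟩ with hσ
  have hreach : ∀ u, reach r m g (extendLabels n σ) u = reach r m g x u := by
    refine fun u => reach_congr r m g (fun v hv => ?_) u
    simp [extendLabels, hv, hσ]
  have hpt : ∀ u, 2 * (sg (x u) * reach r m g x u) - 2 * ((reach r m g x u : ℝ) ^ 2 / L) ≤
      ∑ j, sg (x u) * sg (candidate r L g (σ, j) u) := by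
    intro u
    rw [← Finset.mul_sum]
    simp only [candidate, hreach]
    rw [sum_sg_threshold]
    have h1 := abs_clip_sub_le hL (reach r m g x u)
    set z := reach r m g x u
    have h2 : |sg (x u) * (((max (-(L : ℤ)) (min (L : ℤ) z) : ℤ) : ℝ) - z)| ≤ (z : ℝ) ^ 2 / L := by
      rwa [abs_mul, abs_sg, one_mul]
    have h3 := (abs_le.1 h2).1
    linarith
  have hsum : A ≤ ∑ j, overlap x (candidate r L g (σ, j)) := by
    unfold overlap
    rw [Finset.sum_comm]
    refine le_trans ?_ (Finset.sum_le_sum fun u _ => hpt u)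
    rw [Finset.sum_sub_distrib, ← Finset.mul_sum, ← Finset.mul_sum, ← Finset.sum_div]
    change A ≤ 2 * signal r m g x - 2 * (energy r m g x / L)
    have : energy r m g x / L ≤ A / 2 := by
      rw [div_le_iff₀ hL0]
      linarith
    linarith
  by_contra hcon
  push Not at hcon
  have hne : (Finset.univ : Finset (Fin (2 * L))).Nonempty := ⟨⟨0, by omega⟩, Finset.mem_univ _⟩
  have hlt := Finset.sum_lt_sum_of_nonempty hne fun j _ => hcon (σ, j)
  rw [Finset.sum_const, Finset.card_univ, Fintype.card_fin, nsmul_eq_mul] at hlt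
  have : ((2 * L : ℕ) : ℝ) * (A / (2 * L)) = A := by
    push_cast
    field_simp
  linarith

/-- Maximizing an approximation of the squared overlap gives a labelling with large overlap. -/
lemma le_abs_overlap_of_isMax {K : Type*} {y : K → Fin n → Fin 2} {x : Fin n → Fin 2} {T : K → ℝ}
    {γ τ A : ℝ} (hγ : γ ≠ 0) (hT : ∀ k, |T k - γ / 2 * overlap x (y k) ^ 2| ≤ τ)
    {k₁ k₂ : K} (h₁ : A ≤ overlap x (y k₁)) (hA : 0 ≤ A) (h₂ : ∀ k, γ * T k ≤ γ * T k₂)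
    (hτ : 16 * τ ≤ 3 * (|γ| * A ^ 2)) : A / 2 ≤ |overlap x (y k₂)| := by
  have hγ0 : 0 < |γ| := abs_pos.2 hγ
  have hT' : ∀ k, |γ * T k - γ ^ 2 / 2 * overlap x (y k) ^ 2| ≤ |γ| * τ := by
    intro k
    rw [show γ * T k - γ ^ 2 / 2 * overlap x (y k) ^ 2 =
      γ * (T k - γ / 2 * overlap x (y k) ^ 2) by ring, abs_mul]
    exact mul_le_mul_of_nonneg_left (hT k) hγ0.le
  have e1 := (abs_le.1 (hT' k₁)).1
  have e2 := (abs_le.1 (hT' k₂)).2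
  have e3 := h₂ k₁
  have hA2 : A ^ 2 ≤ overlap x (y k₁) ^ 2 := by gcongr
  have hsq : |γ| ^ 2 = γ ^ 2 := sq_abs γ
  have h5 : γ ^ 2 * A ^ 2 ≤ γ ^ 2 * overlap x (y k₁) ^ 2 :=
    mul_le_mul_of_nonneg_left hA2 (sq_nonneg γ)
  have h6 : |γ| * (16 * τ) ≤ |γ| * (3 * (|γ| * A ^ 2)) := mul_le_mul_of_nonneg_left hτ hγ0.le
  have h7 : γ ^ 2 * (A / 2) ^ 2 ≤ γ ^ 2 * overlap x (y k₂) ^ 2 := by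
    have : |γ| * (3 * (|γ| * A ^ 2)) = 3 * (γ ^ 2 * A ^ 2) := by rw [← hsq]; ring
    linarith
  have h8 : (A / 2) ^ 2 ≤ overlap x (y k₂) ^ 2 :=
    le_of_mul_le_mul_left h7 (by positivity)
  exact (le_abs_self _).trans (sq_le_sq.1 h8)

/-- A randomized estimator whose overlap with the labels is large with high probability. -/
lemma exists_randomized_estimator {a b q D θ C F κ A : ℝ} {r m L : ℕ}
    (hq : 0 ≤ q) (hq1 : q ≤ 1) (ha : a / n ∈ Set.Icc (0 : ℝ) (1 / 2))
    (hb : b / n ∈ Set.Icc (0 : ℝ) (1 / 2))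
    (hs : |(1 - q) * ((a - b) / 2)| ≤ (1 - q) * ((a + b) / 2))
    (hD : (1 - q) * ((a + b) / 2) + |(1 - q) * ((a - b) / 2)| ≤ D) (hD1 : 1 ≤ D) (hDn : D ≤ n)
    (hFa : revealProb q (a / n) ≤ F / n) (hFb : revealProb q (b / n) ≤ F / n)
    (hF : 0 < F) (hκ : 0 < κ) (hκF : κ ≤ 2 * F) (hFn : F / 2 ≤ κ * n)
    (hγ : 0 < |revealGap n a b q|)
    (hA : 0 < A) (hκA : 16 * κ ≤ |revealGap n a b q| * n * A ^ 2)
    (hm : m ≤ n) (hL : 0 < L) (hθ : 0 < θ) (hAL : 2 * A * L ≤ θ) (hθL : 2 * C * θ ≤ L)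
    (hQ : 3 / 2 * θ * n ≤ expect a b q (fun (x : Fin n → Fin 2) h => signal r m (layer h) x))
    (hW : expect a b q (fun (x : Fin n → Fin 2) h => energy r m (layer h) x) ≤
      (C - 1) * θ ^ 2 * n) :
    ∃ f : (VPair n → Bool) → (VPair n → Bool) → Fin n → Fin 2,
      1 - (4 / (θ * n) ^ 2 * (varConst D (r + 1) * n) +
        1 / (θ ^ 2 * n) ^ 2 * (varConst D (2 * (r + 1)) * n) + F / (κ * n ^ 2) * (D * n) +
        2 ^ m * (2 * L) * (2 * Real.exp (-(κ ^ 2 / (4 * F)) * n))) ≤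
      expect a b q (fun x h =>
        if A / 2 * n ≤ |overlap x (f (fun e => (h e).1) (fun e => (h e).2))| then 1 else 0) := by
  have hn0 : (0 : ℝ) < n := by linarith
  have hn : 0 < n := by exact_mod_cast hn0
  have hL0 : (0 : ℝ) < L := by exact_mod_cast hL
  have H : Admissible n a b q := ⟨hq, hq1, ⟨ha.1, by linarith [ha.2]⟩, ⟨hb.1, by linarith [hb.2]⟩⟩
  set γ := revealGap n a b q with hγdef
  set μ := revealMean n a b q with hμdef
  have hγF : |γ| ≤ F / n := by
    have h1 := (revealProb_mem hq hq1 ha.1 ha.2).1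
    have h2 := (revealProb_mem hq hq1 hb.1 hb.2).1
    rw [hγdef, revealGap, abs_le]
    constructor <;> linarith
  have : Nonempty (Fin (2 * L)) := ⟨⟨0, by omega⟩⟩
  have hmax : ∀ h : VPair n → Bool × Bool, ∃ k : (Fin m → Fin 2) × Fin (2 * L), ∀ k',
      γ * testStat μ h (candidate r L (layer h) k') ≤
        γ * testStat μ h (candidate r L (layer h) k) :=
    fun h => Finite.exists_max _
  choose kmax hkmax using hmax
  refine ⟨fun g c => candidate r L (layer fun e => (g e, c e)) (kmax fun e => (g e, c e)), ?_⟩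
  change _ ≤ expect a b q (fun x h =>
    if A / 2 * n ≤ |overlap x (candidate r L (layer h) (kmax h))| then 1 else 0)
  set EQ := expect a b q (fun (x : Fin n → Fin 2) h => signal r m (layer h) x) with hEQ
  set EW := expect a b q (fun (x : Fin n → Fin 2) h => energy r m (layer h) x) with hEW
  set ind : (Fin m → Fin 2) × Fin (2 * L) → (Fin n → Fin 2) → (VPair n → Bool × Bool) → ℝ :=
    fun k x h => if κ * n < |testStat μ h (candidate r L (layer h) k) -
      testMean γ h x (candidate r L (layer h) k)| then 1 else 0 with hind
  have hpt : ∀ x h, 1 ≤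
      (if A / 2 * n ≤ |overlap x (candidate r L (layer h) (kmax h))| then 1 else 0)
      + (4 / (θ * n) ^ 2 * (signal r m (layer h) x - EQ) ^ 2 +
        (1 / (θ ^ 2 * n) ^ 2 * (energy r m (layer h) x - EW) ^ 2 +
          (F / (κ * n ^ 2) * layerCard h + ∑ k, ind k x h))) := by
    intro x h
    have hind0 : ∀ k, 0 ≤ ind k x h := fun k => by simp only [hind]; split_ifs <;> norm_num
    have p1 : (0 : ℝ) ≤ if A / 2 * n ≤ |overlap x (candidate r L (layer h) (kmax h))|
      then 1 else 0 := by split_ifs <;> norm_num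
    have p2 : 0 ≤ 4 / (θ * n) ^ 2 * (signal r m (layer h) x - EQ) ^ 2 := by positivity
    have p3 : 0 ≤ 1 / (θ ^ 2 * n) ^ 2 * (energy r m (layer h) x - EW) ^ 2 := by positivity
    have hlc : 0 ≤ layerCard h := Finset.sum_nonneg fun e _ => by split_ifs <;> norm_num
    have p4 : 0 ≤ F / (κ * n ^ 2) * layerCard h := by positivity
    have p5 : 0 ≤ ∑ k, ind k x h := Finset.sum_nonneg fun k _ => hind0 k
    by_cases c2 : signal r m (layer h) x < θ * n
    · have : 1 ≤ 4 / (θ * n) ^ 2 * (signal r m (layer h) x - EQ) ^ 2 := by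
        rw [div_mul_eq_mul_div, le_div_iff₀ (by positivity), one_mul]
        have : θ * n ≤ 2 * (EQ - signal r m (layer h) x) := by linarith
        have := pow_le_pow_left₀ (by positivity) this 2
        linarith
      linarith
    by_cases c3 : C * θ ^ 2 * n < energy r m (layer h) x
    · have : 1 ≤ 1 / (θ ^ 2 * n) ^ 2 * (energy r m (layer h) x - EW) ^ 2 := by
        rw [div_mul_eq_mul_div, le_div_iff₀ (by positivity), one_mul]
        have : θ ^ 2 * n ≤ energy r m (layer h) x - EW := by linarith
        have := pow_le_pow_left₀ (by positivity) this 2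
        linarith
      linarith
    by_cases c4 : κ * n ^ 2 < F * layerCard h
    · have : 1 ≤ F / (κ * n ^ 2) * layerCard h := by
        rw [div_mul_eq_mul_div, le_div_iff₀ (by positivity), one_mul]
        exact c4.le
      linarith
    by_cases c5 : ∃ k, ind k x h = 1
    · obtain ⟨k, hk⟩ := c5
      have : 1 ≤ ∑ k, ind k x h := by
        rw [← hk]
        exact Finset.single_le_sum (fun k _ => hind0 k) (Finset.mem_univ k)
      linarith
    push Not at c2 c3 c4 c5
    have hdev : ∀ k : (Fin m → Fin 2) × Fin (2 * L), |testStat μ h (candidate r L (layer h) k) -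
        testMean γ h x (candidate r L (layer h) k)| ≤ κ * n := by
      intro k
      by_contra hlt
      exact c5 k (if_pos (not_le.1 hlt))
    obtain ⟨k₁, hk₁⟩ := exists_candidate hm hL (layer h) x c2 c3 (by
      have : C * θ ^ 2 * n * 2 = 2 * C * θ * (θ * n) := by ring
      have := mul_le_mul_of_nonneg_right hθL (show 0 ≤ θ * n by positivity)
      linarith)
    have hk₁' : A * n ≤ overlap x (candidate r L (layer h) k₁) := by
      refine le_trans ?_ hk₁
      rw [le_div_iff₀ (by positivity)]
      have := mul_le_mul_of_nonneg_right hAL hn0.le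
      linarith
    have hT : ∀ k : (Fin m → Fin 2) × Fin (2 * L), |testStat μ h (candidate r L (layer h) k) -
        γ / 2 * overlap x (candidate r L (layer h) k) ^ 2| ≤ 3 * (κ * n) := by
      intro k
      have h1 := hdev k
      have h2 := abs_testMean_sub_le γ h x (candidate r L (layer h) k)
      have h3 : |γ| * layerCard h ≤ κ * n := by
        calc |γ| * layerCard h ≤ F / n * layerCard h := mul_le_mul_of_nonneg_right hγF hlc
          _ = F * layerCard h / n := by ring
          _ ≤ κ * n ^ 2 / n := div_le_div_of_nonneg_right c4 hn0.le
          _ = κ * n := by field_simp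
      have h4 : |γ| * n / 2 ≤ κ * n := by
        have : |γ| * n ≤ F := by rwa [← le_div_iff₀ hn0]
        linarith
      have h5 := abs_sub_le (testStat μ h (candidate r L (layer h) k))
        (testMean γ h x (candidate r L (layer h) k))
        (γ / 2 * overlap x (candidate r L (layer h) k) ^ 2)
      linarith
    have hfin := le_abs_overlap_of_isMax (abs_pos.1 hγ) hT hk₁' (by positivity) (hkmax h) (by
      have := mul_le_mul_of_nonneg_right hκA hn0.le
      have e : |γ| * (A * n) ^ 2 = |γ| * n * A ^ 2 * n := by ring
      rw [e]
      linarith)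
    rw [if_pos (by rwa [div_mul_eq_mul_div])]
    linarith
  have hmono := expect_mono H hpt
  rw [expect_const, expect_add, expect_add, expect_add, expect_add, expect_const_mul,
    expect_const_mul, expect_const_mul, expect_sum] at hmono
  have b1 : 4 / (θ * n) ^ 2 * expect a b q (fun (x : Fin n → Fin 2) h =>
      (signal r m (layer h) x - EQ) ^ 2) ≤ 4 / (θ * n) ^ 2 * (varConst D (r + 1) * n) :=
    mul_le_mul_of_nonneg_left (variance_signal_le hs hD hD1 hDn) (by positivity)
  have b2 : 1 / (θ ^ 2 * n) ^ 2 * expect a b q (fun (x : Fin n → Fin 2) h =>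
      (energy r m (layer h) x - EW) ^ 2) ≤
        1 / (θ ^ 2 * n) ^ 2 * (varConst D (2 * (r + 1)) * n) :=
    mul_le_mul_of_nonneg_left (variance_energy_le hs hD hD1 hDn) (by positivity)
  have b3 : F / (κ * n ^ 2) * expect a b q (fun (_ : Fin n → Fin 2) h => layerCard h) ≤
      F / (κ * n ^ 2) * (D * n) :=
    mul_le_mul_of_nonneg_left (expect_layerCard_le hs hD hn) (by positivity)
  have b4 : ∑ k, expect a b q (ind k) ≤
      2 ^ m * (2 * L) * (2 * Real.exp (-(κ ^ 2 / (4 * F)) * n)) := by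
    refine (Finset.sum_le_sum fun k _ => prob_testStat_le H ha hb hFa hFb hn hF hκ.le hκF
      fun g => candidate r L g k).trans (le_of_eq ?_)
    rw [Finset.sum_const, Finset.card_univ, nsmul_eq_mul]
    simp
  linarith

lemma sbmMass_eq (a b : ℝ) (x : Fin n → Fin 2) (g : VPair n → Bool) :
    sbmMass (fun _ : Fin 2 => (1 : ℝ) / 2) (ssbmW 2 (a / n) (b / n)) x g =
      (1 / 2) ^ n * ∏ e : VPair n, if g e then edgeProb a b x e else 1 - edgeProb a b x e := by
  simp [sbmMass, edgeProb]

lemma expect_eq_sum (a b q : ℝ) (F : (Fin n → Fin 2) → (VPair n → Bool) → (VPair n → Bool) → ℝ) :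
    expect a b q (fun x h => F x (fun e => (h e).1) (fun e => (h e).2)) =
      ∑ x, ∑ g, ∑ c : VPair n → Bool,
        sbmMass (fun _ : Fin 2 => (1 : ℝ) / 2) (ssbmW 2 (a / n) (b / n)) x g *
          (∏ e, if c e then q else 1 - q) * F x g c := by
  unfold expect avg
  rw [Finset.mul_sum]
  refine Finset.sum_congr rfl fun x _ => ?_
  rw [← (Equiv.arrowProdEquivProdArrow (VPair n) (fun _ => Bool) (fun _ => Bool)).symm.sum_comp,
    Fintype.sum_prod_type, Finset.mul_sum]
  refine Finset.sum_congr rfl fun g _ => ?_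
  rw [Finset.mul_sum]
  refine Finset.sum_congr rfl fun c _ => ?_
  rw [sbmMass_eq]
  unfold weight pairWeight
  rw [Finset.prod_mul_distrib]
  simp only [Equiv.arrowProdEquivProdArrow_symm_apply]
  ring

/-- Randomized estimators can be derandomized. -/
lemma exists_estimator {a b q : ℝ} (H : Admissible n a b q) (hn : 0 < n) {A : ℝ}
    (f : (VPair n → Bool) → (VPair n → Bool) → Fin n → Fin 2) :
    ∃ est : (VPair n → Bool) → Fin n → Fin 2,
      expect a b q (fun x h =>
        if A * n ≤ |overlap x (f (fun e => (h e).1) (fun e => (h e).2))| then 1 else 0) ≤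
      sbmProb (fun _ : Fin 2 => (1 : ℝ) / 2) (ssbmW 2 (a / n) (b / n))
        fun x g => 1 / 2 + A / 2 ≤ agreement x (est g) := by
  have hw : ∀ c : VPair n → Bool, 0 ≤ ∏ e, if c e then q else 1 - q := fun c =>
    Finset.prod_nonneg fun e _ => by
      have := H.q_nonneg
      have := H.q_le_one
      split_ifs <;> linarith
  have hw1 : ∑ c : VPair n → Bool, ∏ e, (if c e then q else 1 - q) = 1 := by
    rw [← Fintype.prod_sum (fun (_ : VPair n) (c : Bool) => if c then q else 1 - q)]
    simp
  have hmass : ∀ (x : Fin n → Fin 2) (g : VPair n → Bool), 0 ≤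
      sbmMass (fun _ : Fin 2 => (1 : ℝ) / 2) (ssbmW 2 (a / n) (b / n)) x g := by
    intro x g
    rw [sbmMass_eq]
    refine mul_nonneg (by positivity) (Finset.prod_nonneg fun e _ => ?_)
    have := edgeProb_mem x e H.a_mem H.b_mem
    split_ifs
    · exact this.1
    · linarith [this.2]
  obtain ⟨est, hest⟩ := exists_deterministic
    (fun c : VPair n → Bool => ∏ e, if c e then q else 1 - q)
    hw hw1 (sbmMass (fun _ : Fin 2 => (1 : ℝ) / 2) (ssbmW 2 (a / n) (b / n))) f
    (fun x y => A * n ≤ |overlap x y|)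
  refine ⟨est, le_trans (le_of_eq ?_) (hest.trans ?_)⟩
  · rw [expect_eq_sum a b q (fun x g c => if A * n ≤ |overlap x (f g c)| then 1 else 0)]
    simp only [mul_ite, mul_one, mul_zero]
  · refine Finset.sum_le_sum fun x _ => Finset.sum_le_sum fun g _ => ?_
    by_cases hov : A * n ≤ |overlap x (est g)|
    · rw [if_pos hov, if_pos (le_agreement hn x (est g) hov)]
    · rw [if_neg hov]
      split_ifs
      · exact hmass x g
      · exact le_rfl

lemma sbmProb_le_one {a b q : ℝ} (H : Admissible n a b q)
    (E : (Fin n → Fin 2) → (VPair n → Bool) → Prop) :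
    sbmProb (fun _ : Fin 2 => (1 : ℝ) / 2) (ssbmW 2 (a / n) (b / n)) E ≤ 1 := by
  have hsum : ∀ x : Fin n → Fin 2, ∑ g : VPair n → Bool,
      ∏ e, (if g e then edgeProb a b x e else 1 - edgeProb a b x e) = 1 := by
    intro x
    rw [← Fintype.prod_sum (fun (e : VPair n) (c : Bool) =>
      if c then edgeProb a b x e else 1 - edgeProb a b x e)]
    simp
  calc _ ≤ ∑ x : Fin n → Fin 2, ∑ g : VPair n → Bool,
        sbmMass (fun _ : Fin 2 => (1 : ℝ) / 2) (ssbmW 2 (a / n) (b / n)) x g := by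
        refine Finset.sum_le_sum fun x _ => Finset.sum_le_sum fun g _ => ?_
        split_ifs
        · exact le_rfl
        · rw [sbmMass_eq]
          refine mul_nonneg (by positivity) (Finset.prod_nonneg fun e _ => ?_)
          have := edgeProb_mem x e H.a_mem H.b_mem
          split_ifs
          · exact this.1
          · linarith [this.2]
    _ = 1 := by
      simp_rw [sbmMass_eq, ← Finset.mul_sum, hsum]
      simp

lemma le_expect_signal {a b q δ : ℝ} {r m : ℕ} (hn : 0 < n) (hm : m ≤ n) (hδm : δ * n ≤ m)
    (hpos : 0 ≤ ((1 - q) * ((a - b) / 2)) ^ r)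
    (hsmall : Real.exp 1 * ((r + 1 : ℕ) : ℝ) ^ (r + 1) ≤ δ * n / 4) :
    3 / 2 * (δ * ((1 - q) * ((a - b) / 2)) ^ r / 2) * n ≤
      expect a b q (fun (x : Fin n → Fin 2) h => signal r m (layer h) x) := by
  have hn0 : (0 : ℝ) < n := by exact_mod_cast hn
  rw [expect_signal, div_pow]
  set S := ((1 - q) * ((a - b) / 2)) ^ r
  calc 3 / 2 * (δ * S / 2) * n = (δ * n - δ * n / 4) * S := by ring
    _ ≤ (m - Real.exp 1 * ((r + 1 : ℕ) : ℝ) ^ (r + 1)) * S :=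
      mul_le_mul_of_nonneg_right (by linarith) hpos
    _ = (n : ℝ) ^ r * (m - Real.exp 1 * ((r + 1 : ℕ) : ℝ) ^ (r + 1)) * (S / n ^ r) := by
      field_simp
    _ ≤ _ := mul_le_mul_of_nonneg_right (le_card_walks hn r hm) (by positivity)

lemma expect_energy_le_const {a b q D δ ρ : ℝ} {r m : ℕ}
    (hs : |(1 - q) * ((a - b) / 2)| ≤ (1 - q) * ((a + b) / 2))
    (hD : (1 - q) * ((a + b) / 2) + |(1 - q) * ((a - b) / 2)| ≤ D) (hD1 : 1 ≤ D) (hDn : D ≤ n)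
    (hm : m ≤ n) (hs0 : (1 - q) * ((a - b) / 2) ≠ 0)
    (hρ : (1 - q) * ((a + b) / 2) = ρ * ((1 - q) * ((a - b) / 2)) ^ 2)
    (hρ0 : 0 ≤ ρ) (hρ1 : ρ < 1) (hmδ : m ≤ 2 * δ * n) (hρr : ρ ^ r ≤ δ)
    (hθ : 1 ≤ δ * ((1 - q) * ((a - b) / 2)) ^ r / 2) (hV : varConst D (r + 1) ≤ n) :
    expect a b q (fun (x : Fin n → Fin 2) h => energy r m (layer h) x) ≤
      (16 / (1 - ρ) + 10 - 1) * (δ * ((1 - q) * ((a - b) / 2)) ^ r / 2) ^ 2 * n := by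
  have hn0 : (0 : ℝ) < n := by linarith
  have hδ : 0 ≤ δ := (pow_nonneg hρ0 r).trans hρr
  have h1ρ : 0 < 1 - ρ := by linarith
  refine (expect_energy_le hs hD hD1 hDn hm hs0 hρ).trans ?_
  set S := ((1 - q) * ((a - b) / 2)) ^ r with hS
  rw [mul_comm 2 r, pow_mul, ← hS]
  have hgeom : ∑ t ∈ Finset.range r, ρ ^ t ≤ 1 / (1 - ρ) := by
    rw [le_div_iff₀ h1ρ, geom_sum_mul_neg]
    linarith [pow_nonneg hρ0 r]
  have hm2 : (m : ℝ) ^ 2 / n ≤ 4 * δ ^ 2 * n := by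
    rw [div_le_iff₀ hn0]
    calc (m : ℝ) ^ 2 ≤ (2 * δ * n) ^ 2 := by gcongr
      _ = _ := by ring
  have h1 : (m : ℝ) ^ 2 / n * ∑ t ∈ Finset.range r, ρ ^ t ≤ 4 * δ ^ 2 * n * (1 / (1 - ρ)) :=
    mul_le_mul hm2 hgeom (Finset.sum_nonneg fun t _ => pow_nonneg hρ0 t) (by positivity)
  have h2 : (m : ℝ) * ρ ^ r ≤ 2 * δ * n * δ := mul_le_mul hmδ hρr (pow_nonneg hρ0 r) (by positivity)
  have h3 : (n : ℝ) ≤ (δ * S / 2) ^ 2 * n := le_mul_of_one_le_left hn0.le (one_le_pow₀ hθ)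
  calc S ^ 2 * ((m : ℝ) ^ 2 / n * ∑ t ∈ Finset.range r, ρ ^ t + m * ρ ^ r) + varConst D (r + 1)
      ≤ S ^ 2 * (4 * δ ^ 2 * n * (1 / (1 - ρ)) + 2 * δ * n * δ) + (δ * S / 2) ^ 2 * n :=
        add_le_add (mul_le_mul_of_nonneg_left (add_le_add h1 h2) (sq_nonneg S)) (hV.trans h3)
    _ = _ := by ring

lemma tendsto_error {V₁ V₂ θ F κ D δ : ℝ} {L : ℕ} {m : ℕ → ℕ} (hθ : 0 < θ) (hF : 0 < F)
    (hκ : 0 < κ) (hδ : 2 * δ ≤ κ ^ 2 / (8 * F)) (hm : ∀ᶠ n : ℕ in atTop, (m n : ℝ) ≤ 2 * δ * n) :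
    Tendsto (fun n : ℕ => 1 - (4 / (θ * n) ^ 2 * (V₁ * n) + 1 / (θ ^ 2 * n) ^ 2 * (V₂ * n) +
      F / (κ * n ^ 2) * (D * n) + 2 ^ m n * (2 * L) * (2 * Real.exp (-(κ ^ 2 / (4 * F)) * n))))
      atTop (nhds (1 : ℝ)) := by
  have hinv : Tendsto (fun n : ℕ => (4 / θ ^ 2 * V₁ + 1 / (θ ^ 2) ^ 2 * V₂ + F / κ * D) / (n : ℝ))
      atTop (nhds 0) := tendsto_const_div_atTop_nhds_zero_nat _
  have hexp : Tendsto (fun n : ℕ => 4 * (L : ℝ) * Real.exp (-(κ ^ 2 / (8 * F) * n)))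
      atTop (nhds 0) := by
    rw [← mul_zero (4 * (L : ℝ))]
    refine Tendsto.const_mul _ (Real.tendsto_exp_neg_atTop_nhds_zero.comp ?_)
    exact tendsto_natCast_atTop_atTop.const_mul_atTop (by positivity)
  have hlast : Tendsto (fun n : ℕ =>
      (2 : ℝ) ^ m n * (2 * L) * (2 * Real.exp (-(κ ^ 2 / (4 * F)) * n))) atTop (nhds 0) := by
    refine squeeze_zero' (Eventually.of_forall fun n => by positivity) ?_ hexp
    filter_upwards [hm] with n hn
    have h1 : (2 : ℝ) ^ m n ≤ Real.exp (κ ^ 2 / (8 * F) * n) := by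
      calc (2 : ℝ) ^ m n ≤ Real.exp 1 ^ m n := by
            refine pow_le_pow_left₀ (by norm_num) ?_ _
            linarith [Real.add_one_le_exp (1 : ℝ)]
        _ = Real.exp (m n) := by rw [← Real.exp_nat_mul, mul_one]
        _ ≤ _ := Real.exp_le_exp.2 (hn.trans (mul_le_mul_of_nonneg_right hδ (Nat.cast_nonneg n)))
    calc (2 : ℝ) ^ m n * (2 * L) * (2 * Real.exp (-(κ ^ 2 / (4 * F)) * n)) ≤
        Real.exp (κ ^ 2 / (8 * F) * n) * (2 * L) * (2 * Real.exp (-(κ ^ 2 / (4 * F)) * n)) := by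
          gcongr
      _ = 4 * L * (Real.exp (κ ^ 2 / (8 * F) * n) * Real.exp (-(κ ^ 2 / (4 * F)) * n)) := by ring
      _ = _ := by
        rw [← Real.exp_add]
        congr 2
        field_simp
        ring
  have hsum := hinv.add hlast
  rw [add_zero] at hsum
  rw [show nhds (1 : ℝ) = nhds (1 - 0) by rw [sub_zero]]
  refine Tendsto.sub tendsto_const_nhds (hsum.congr' ?_)
  filter_upwards [eventually_gt_atTop 0] with n hn
  have hn0 : (n : ℝ) ≠ 0 := by exact_mod_cast hn.ne'
  field_simp

/-- Above the threshold, a constant fraction of the edges can be set aside while staying above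
the threshold. -/
lemma exists_thinning {d s : ℝ} (hds : d < s ^ 2) (hs : |s| ≤ d) :
    ∃ q ρ : ℝ, 0 < q ∧ q ≤ 1 ∧ 0 ≤ ρ ∧ ρ < 1 ∧ 1 < |(1 - q) * s| ∧
      (1 - q) * d = ρ * ((1 - q) * s) ^ 2 := by
  have hd : 0 < d := by
    rcases eq_or_lt_of_le ((abs_nonneg s).trans hs) with h0 | h0
    · rw [← h0] at hs hds
      have : s = 0 := abs_eq_zero.1 (le_antisymm hs (abs_nonneg s))
      simp [this] at hds
    · exact h0
  have hs2 : 0 < s ^ 2 := hd.trans hds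
  set q := (s ^ 2 - d) / (2 * s ^ 2) with hq
  have hq' : 1 - q = (s ^ 2 + d) / (2 * s ^ 2) := by
    rw [hq, eq_div_iff (by linarith), sub_mul, div_mul_cancel₀ _ (by linarith)]
    ring
  have hq0 : 0 < q := div_pos (by linarith) (by linarith)
  have hq1 : 0 < 1 - q := by rw [hq']; positivity
  have hlt : (1 - q) * d < ((1 - q) * s) ^ 2 := by
    have : (1 - q) * s ^ 2 = (s ^ 2 + d) / 2 := by
      rw [hq', div_mul_eq_mul_div, div_eq_div_iff (by linarith) two_ne_zero]
      ring
    calc (1 - q) * d < (1 - q) * ((1 - q) * s ^ 2) :=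
          mul_lt_mul_of_pos_left (by linarith) hq1
      _ = _ := by ring
  have hpos : 0 < ((1 - q) * s) ^ 2 := lt_trans (by positivity) hlt
  have habs : |(1 - q) * s| ≤ (1 - q) * d := by
    rw [abs_mul, abs_of_pos hq1]
    exact mul_le_mul_of_nonneg_left hs hq1.le
  refine ⟨q, (1 - q) * d / ((1 - q) * s) ^ 2, hq0, by linarith, by positivity,
    (div_lt_one hpos).2 hlt, ?_, (div_mul_cancel₀ _ hpos.ne').symm⟩
  by_contra hle
  push Not at hle
  rw [← sq_abs] at hlt
  nlinarith [abs_nonneg ((1 - q) * s)]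

lemma exists_even_length {ρ s δ : ℝ} (hρ0 : 0 ≤ ρ) (hρ1 : ρ < 1) (hs : 1 < |s|) (hδ : 0 < δ) :
    ∃ r : ℕ, ρ ^ r ≤ δ ∧ 1 ≤ δ * s ^ r / 2 := by
  have h1 := (tendsto_pow_atTop_nhds_zero_of_lt_one hρ0 hρ1).eventually (ge_mem_nhds hδ)
  have h2 := (tendsto_pow_atTop_atTop_of_one_lt hs).eventually_ge_atTop (2 / δ)
  obtain ⟨N, hN⟩ := eventually_atTop.1 (h1.and h2)
  obtain ⟨hN1, hN2⟩ := hN (2 * N) (by omega)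
  refine ⟨2 * N, hN1, ?_⟩
  rw [pow_mul, sq_abs, ← pow_mul, div_le_iff₀ hδ] at hN2
  linarith

/-- Choosing an estimator for every size from an eventual lower bound. -/
lemma exists_tendsto_one {Y : ℕ → Type*} [∀ n, Nonempty (Y n)] {P : (n : ℕ) → Y n → ℝ} {B : ℕ → ℝ}
    (hB : Tendsto B atTop (nhds 1)) (h : ∀ᶠ n in atTop, (∀ y, P n y ≤ 1) ∧ ∃ y, B n ≤ P n y) :
    ∃ est : (n : ℕ) → Y n, Tendsto (fun n => P n (est n)) atTop (nhds 1) := by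
  have hex : ∀ n, ∃ y, (∃ y', B n ≤ P n y') → B n ≤ P n y := by
    intro n
    by_cases hn : ∃ y', B n ≤ P n y'
    · exact hn.imp fun y hy _ => hy
    · exact ⟨Classical.arbitrary _, fun hn' => absurd hn' hn⟩
  choose est hest using hex
  refine ⟨est, tendsto_of_tendsto_of_tendsto_of_le_of_le' hB tendsto_const_nhds ?_ ?_⟩
  · exact h.mono fun n hn => hest n hn.2
  · exact h.mono fun n hn => hn.1 _

/-- For large graphs there is an estimator whose agreement is bounded below with high
probability. -/
lemma exists_estimator_of_large {n : ℕ} {a b q D ρ δ A κ F C θ : ℝ} {r L : ℕ} (ha : 0 ≤ a)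
    (hb : 0 ≤ b) (hq0 : 0 < q) (hq1 : q ≤ 1)
    (hs : |(1 - q) * ((a - b) / 2)| ≤ (1 - q) * ((a + b) / 2))
    (hD : (1 - q) * ((a + b) / 2) + |(1 - q) * ((a - b) / 2)| ≤ D) (haD : a ≤ D) (hbD : b ≤ D)
    (hD1 : 1 ≤ D) (hs0 : (1 - q) * ((a - b) / 2) ≠ 0)
    (hρ : (1 - q) * ((a + b) / 2) = ρ * ((1 - q) * ((a - b) / 2)) ^ 2)
    (hρ0 : 0 ≤ ρ) (hρ1 : ρ < 1) (hρr : ρ ^ r ≤ δ)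
    (hpos : 0 ≤ ((1 - q) * ((a - b) / 2)) ^ r)
    (hθ : θ = δ * ((1 - q) * ((a - b) / 2)) ^ r / 2) (hθ1 : 1 ≤ θ) (hC : C = 16 / (1 - ρ) + 10)
    (hA0 : 0 < A) (hκ : κ = q * |(a - b) / 2| * A ^ 2 / 16) (hF : F = 2 * D) (hκF : κ ≤ 2 * F)
    (hδ1 : 2 * δ ≤ 1) (hL0 : 0 < L) (hAL : 2 * A * L ≤ θ) (hθL : 2 * C * θ ≤ L)
    (hmn : ((⌈δ * n⌉₊ : ℕ) : ℝ) ≤ 2 * δ * n) (hDn : 2 * D ≤ n) (hVn : varConst D (r + 1) ≤ n)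
    (hEn : Real.exp 1 * ((r + 1 : ℕ) : ℝ) ^ (r + 1) ≤ δ * n / 4) (hFn : F / 2 ≤ κ * n) :
    Admissible n a b q ∧ ∃ est : (VPair n → Bool) → Fin n → Fin 2,
      1 - (4 / (θ * n) ^ 2 * (varConst D (r + 1) * n) +
        1 / (θ ^ 2 * n) ^ 2 * (varConst D (2 * (r + 1)) * n) + F / (κ * n ^ 2) * (D * n) +
        2 ^ ⌈δ * n⌉₊ * (2 * L) * (2 * Real.exp (-(κ ^ 2 / (4 * F)) * n))) ≤
      sbmProb (fun _ : Fin 2 => (1 : ℝ) / 2) (ssbmW 2 (a / n) (b / n))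
        fun x g => 1 / 2 + A / 2 / 2 ≤ agreement x (est g) := by
  have hab0 : 0 < |(a - b) / 2| := abs_pos.2 (right_ne_zero_of_mul hs0)
  have hF0 : 0 < F := by linarith
  have hκ0 : 0 < κ := by rw [hκ]; positivity
  have hθ0 : 0 < θ := by linarith
  subst hθ hC
  have hn0 : (0 : ℝ) < n := by linarith
  have hn : 0 < n := by exact_mod_cast hn0
  have ha' : a / n ∈ Set.Icc (0 : ℝ) (1 / 2) := by
    refine ⟨by positivity, ?_⟩
    rw [div_le_iff₀ hn0]
    linarith
  have hb' : b / n ∈ Set.Icc (0 : ℝ) (1 / 2) := by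
    refine ⟨by positivity, ?_⟩
    rw [div_le_iff₀ hn0]
    linarith
  have H : Admissible n a b q :=
    ⟨hq0.le, hq1, ⟨ha'.1, by linarith [ha'.2]⟩, ⟨hb'.1, by linarith [hb'.2]⟩⟩
  have hFa : revealProb q (a / n) ≤ F / n := by
    refine (revealProb_mem hq0.le hq1 ha'.1 ha'.2).2.trans ?_
    rw [← mul_div_assoc]
    exact div_le_div_of_nonneg_right (by linarith) hn0.le
  have hFb : revealProb q (b / n) ≤ F / n := by
    refine (revealProb_mem hq0.le hq1 hb'.1 hb'.2).2.trans ?_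
    rw [← mul_div_assoc]
    exact div_le_div_of_nonneg_right (by linarith) hn0.le
  have hγ : q * |(a - b) / 2| ≤ |revealGap n a b q| * n := by
    have h1 := le_abs_revealProb_sub hq0.le hq1 ha'.1 ha'.2 hb'.1 hb'.2
    rw [← sub_div, abs_div, Nat.abs_cast, ← mul_div_assoc, div_le_iff₀ hn0] at h1
    rw [revealGap, abs_div, abs_div, abs_two]
    linarith
  have hγ0 : 0 < |revealGap n a b q| :=
    pos_of_mul_pos_left (lt_of_lt_of_le (by positivity) hγ) hn0.le
  have hm' : ⌈δ * n⌉₊ ≤ n := by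
    have : ((⌈δ * n⌉₊ : ℕ) : ℝ) ≤ n :=
      hmn.trans (mul_le_of_le_one_left hn0.le hδ1)
    exact_mod_cast this
  obtain ⟨f, hf⟩ := exists_randomized_estimator hq0.le hq1 ha' hb' hs hD hD1 (by linarith)
    hFa hFb hF0 hκ0 hκF hFn hγ0 hA0 (by
      have := mul_le_mul_of_nonneg_right hγ (sq_nonneg A)
      linarith) hm' hL0 hθ0 hAL hθL
    (le_expect_signal hn hm' (Nat.le_ceil _) hpos hEn)
    (expect_energy_le_const hs hD hD1 (by linarith) hm' hs0 hρ hρ0 hρ1 hmn hρr hθ1 hVn)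
  obtain ⟨est, hest⟩ := exists_estimator H hn (A := A / 2) f
  exact ⟨H, est, hf.trans hest⟩

end BlockModel

open BlockModel in
/-- Above the Kesten–Stigum threshold, weak recovery is solvable in
`SSBM(n, 2, a/n, b/n)`: if `(a−b)² > 2(a+b)`, some estimator achieves agreement
`1/2 + ε` with probability tending to one. -/
theorem weak_recovery_above_KS (a b : ℝ) (ha : 0 ≤ a) (hb : 0 ≤ b)
    (h : 2 * (a + b) < (a - b) ^ 2) :
    ∃ ε > (0 : ℝ), ∃ est : (n : ℕ) → (VPair n → Bool) → (Fin n → Fin 2),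
      Tendsto
        (fun n : ℕ =>
          sbmProb (fun _ : Fin 2 => (1 : ℝ) / 2) (ssbmW 2 (a / n) (b / n))
            fun x g => 1 / 2 + ε ≤ agreement x (est n g))
        atTop (nhds 1) := by
  have hsd : |(a - b) / 2| ≤ (a + b) / 2 := abs_le.2 ⟨by linarith, by linarith⟩
  obtain ⟨q, ρ, hq0, hq1, hρ0, hρ1, hs1, hρ⟩ := exists_thinning (by linarith) hsd
  have hs : |(1 - q) * ((a - b) / 2)| ≤ (1 - q) * ((a + b) / 2) := by
    rw [abs_mul, abs_of_nonneg (by linarith)]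
    exact mul_le_mul_of_nonneg_left hsd (by linarith)
  have hs0 : (1 - q) * ((a - b) / 2) ≠ 0 := abs_pos.1 (by linarith)
  have hab0 : 0 < |(a - b) / 2| := abs_pos.2 (right_ne_zero_of_mul hs0)
  set D := a + b with hDdef
  have hdD : (1 - q) * (D / 2) ≤ D / 2 :=
    mul_le_of_le_one_left (by linarith) (by linarith)
  have hD : (1 - q) * (D / 2) + |(1 - q) * ((a - b) / 2)| ≤ D := by linarith
  have hD1 : 1 ≤ D := by linarith
  set C := 16 / (1 - ρ) + 10 with hC
  have hC10 : 10 ≤ C := by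
    have : 0 ≤ 16 / (1 - ρ) := div_nonneg (by norm_num) (by linarith)
    linarith
  set A := 1 / (6 * C) with hA
  have hA0 : 0 < A := by positivity
  have hA1 : A ≤ 1 := by
    rw [hA, div_le_one (by positivity)]
    linarith
  set κ := q * |(a - b) / 2| * A ^ 2 / 16 with hκ
  have hκ0 : 0 < κ := by positivity
  set F := 2 * D with hF
  have hF0 : 0 < F := by linarith
  have hκF : κ ≤ 2 * F := by
    have h1 : q * |(a - b) / 2| * A ^ 2 ≤ 1 * (D / 2) * 1 :=
      mul_le_mul (mul_le_mul hq1 hsd hab0.le zero_le_one) (pow_le_one₀ hA0.le hA1)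
        (sq_nonneg A) (by linarith)
    linarith
  set δ := min (1 / 2) (κ ^ 2 / (16 * F)) with hδ
  have hδ0 : 0 < δ := lt_min (by norm_num) (by positivity)
  have hδ1 : 2 * δ ≤ 1 := by linarith [min_le_left (1 / 2) (κ ^ 2 / (16 * F))]
  have hδ2 : 2 * δ ≤ κ ^ 2 / (8 * F) := by
    have h1 := min_le_right (1 / 2) (κ ^ 2 / (16 * F))
    have h2 : κ ^ 2 / (8 * F) = 2 * (κ ^ 2 / (16 * F)) := by field_simp; norm_num
    linarith
  obtain ⟨r, hρr, hθ1⟩ := exists_even_length hρ0 hρ1 hs1 hδ0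
  have hpos : 0 ≤ ((1 - q) * ((a - b) / 2)) ^ r := by
    by_contra hneg
    nlinarith
  set θ := δ * ((1 - q) * ((a - b) / 2)) ^ r / 2 with hθ
  have hθ0 : 0 < θ := by linarith
  set L := ⌈2 * C * θ⌉₊ with hL
  have hθL : 2 * C * θ ≤ L := Nat.le_ceil _
  have hCθ : 1 ≤ C * θ := by nlinarith
  have hL0 : 0 < L := Nat.ceil_pos.2 (by positivity)
  have hAL : 2 * A * L ≤ θ := by
    have h1 : (L : ℝ) < 2 * C * θ + 1 := Nat.ceil_lt_add_one (by positivity)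
    calc 2 * A * L ≤ 2 * A * (3 * C * θ) := mul_le_mul_of_nonneg_left (by linarith) (by positivity)
      _ = θ := by rw [hA]; field_simp; norm_num
  have hcast : Tendsto (fun n : ℕ => (n : ℝ)) atTop atTop := tendsto_natCast_atTop_atTop
  have hm : ∀ᶠ n : ℕ in atTop, ((⌈δ * n⌉₊ : ℕ) : ℝ) ≤ 2 * δ * n := by
    filter_upwards [hcast.eventually_ge_atTop (1 / δ)] with n hn
    rw [div_le_iff₀ hδ0] at hn
    have := Nat.ceil_lt_add_one (show 0 ≤ δ * n by positivity)
    linarith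
  have herr := tendsto_error (V₁ := varConst D (r + 1)) (V₂ := varConst D (2 * (r + 1)))
    (D := D) (L := L) hθ0 hF0 hκ0 hδ2 hm
  clear_value L θ δ κ F A C
  refine ⟨A / 2 / 2, by positivity, exists_tendsto_one
    (Y := fun n => (VPair n → Bool) → Fin n → Fin 2)
    (P := fun n e => sbmProb (fun _ : Fin 2 => (1 : ℝ) / 2) (ssbmW 2 (a / n) (b / n))
      fun x g => 1 / 2 + A / 2 / 2 ≤ agreement x (e g)) herr ?_⟩
  filter_upwards [hm, hcast.eventually_ge_atTop (2 * D),
    hcast.eventually_ge_atTop (varConst D (r + 1)),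
    hcast.eventually_ge_atTop (4 * (Real.exp 1 * ((r + 1 : ℕ) : ℝ) ^ (r + 1)) / δ),
    hcast.eventually_ge_atTop (F / 2 / κ)] with n hmn hDn hVn hEn hFn
  rw [div_le_iff₀ hδ0] at hEn
  rw [div_le_iff₀ hκ0, mul_comm] at hFn
  obtain ⟨H, hest⟩ := exists_estimator_of_large ha hb hq0 hq1 hs hD (by linarith) (by linarith)
    hD1 hs0 hρ hρ0 hρ1 hρr hpos hθ hθ1 hC hA0 hκ hF hκF hδ1 hL0 hAL hθL hmn hDn hVn
    (by linarith) hFn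
  exact ⟨fun _ => sbmProb_le_one H _, hest⟩
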